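/- arXiv:1511.09208 — 13 statements merged into one kernel-verified Lean document; each statement's English description precedes it below -/
import Mathlib

section
/- Let M=(f,p) be a pay-your-bid mechanism whose allocation rule f is an exact declared-welfare maximizer over Ω. If M is (λ,μ)-smooth, then M is (λ/2,μ)-smooth for deviations to half the value; that is, for every valuation profile v and every bid profile b, ∑_{i∈N} u_i(((1/2)·v_i, b_{-i}), v_i) ≥ (λ/2)·OPT(v) − μ·∑_{i∈N} p_i(b). -/
open Finset

/-- Against fixed opposing bids, a truthful report `w` to an exact declared-welfare maximizer secures
at least the pay-your-bid utility that an agent with valuation `w` gets from any bid `c`. -/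
theorem deviation_utility_le_of_welfare_maximizer
    {Ω N : Type*} [Fintype N] [DecidableEq N]
    (f : (N → Ω → ℝ) → Ω)
    (hf : ∀ b : N → Ω → ℝ, (∀ i x, 0 ≤ b i x) →
      ∀ x : Ω, ∑ i, b i (f b) ≥ ∑ i, b i x)
    (b : N → Ω → ℝ) (hb : ∀ i x, 0 ≤ b i x) (i : N) (c w : Ω → ℝ)
    (hc : ∀ x, 0 ≤ c x) (hw : ∀ x, 0 ≤ w x) :
    w (f (Function.update b i c)) - c (f (Function.update b i c))
      ≤ w (f (Function.update b i w)) := by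
  have split : ∀ (d : Ω → ℝ) (x : Ω),
      ∑ j, Function.update b i d j x = d x + ∑ j ∈ univ.erase i, b j x := by
    intro d x
    rw [← Finset.add_sum_erase univ _ (Finset.mem_univ i), Function.update_self]
    congr 1
    refine Finset.sum_congr rfl fun j hj => ?_
    rw [Function.update_of_ne (Finset.ne_of_mem_erase hj)]
  have nonneg : ∀ d : Ω → ℝ, (∀ x, 0 ≤ d x) → ∀ j x, 0 ≤ Function.update b i d j x := by
    intro d hd j x
    rcases eq_or_ne j i with rfl | hj
    · simpa using hd x
    · simpa [Function.update_of_ne hj] using hb j x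
  have hw_max := hf _ (nonneg w hw) (f (Function.update b i c))
  have hc_max := hf _ (nonneg c hc) (f (Function.update b i w))
  rw [split, split] at hw_max hc_max
  linarith [hc (f (Function.update b i w))]

/-- If the pay-your-bid mechanism `M = (f, p)` with an exact
declared-welfare maximizing allocation rule `f` is `(λ, μ)`-smooth, then it is
`(λ/2, μ)`-smooth for deviations to half the value. -/
theorem payYourBid_smooth_implies_half_smooth
    {Ω N : Type*} [Fintype Ω] [Nonempty Ω] [Fintype N] [DecidableEq N]
    (f : (N → Ω → ℝ) → Ω)
    (hf : ∀ b : N → Ω → ℝ, (∀ i x, 0 ≤ b i x) →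
      ∀ x : Ω, ∑ i, b i (f b) ≥ ∑ i, b i x)
    (lam mu : ℝ) (hlam : 0 ≤ lam) (hmu : 0 ≤ mu)
    (hsmooth : ∀ v b : N → Ω → ℝ, (∀ i x, 0 ≤ v i x) → (∀ i x, 0 ≤ b i x) →
      ∃ b' : N → Ω → ℝ, (∀ i x, 0 ≤ b' i x) ∧
        ∑ i, (v i (f (Function.update b i (b' i))) - b' i (f (Function.update b i (b' i))))
          ≥ lam * univ.sup' univ_nonempty (fun x => ∑ i, v i x) - mu * ∑ i, b i (f b))
    (v b : N → Ω → ℝ) (hv : ∀ i x, 0 ≤ v i x) (hb : ∀ i x, 0 ≤ b i x) :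
    ∑ i, (v i (f (Function.update b i (fun x => v i x / 2)))
          - v i (f (Function.update b i (fun x => v i x / 2))) / 2)
      ≥ lam / 2 * univ.sup' univ_nonempty (fun x => ∑ i, v i x) - mu * ∑ i, b i (f b) := by
  obtain ⟨b', hb', h⟩ := hsmooth (fun i x => v i x / 2) b (fun i x => by linarith [hv i x]) hb
  have hopt : univ.sup' univ_nonempty (fun x => ∑ i, v i x / 2)
      = univ.sup' univ_nonempty (fun x => ∑ i, v i x) / 2 := by
    rw [Finset.sup'_div₀ zero_le_two]
    simp only [Finset.sum_div]
  rw [hopt] at h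
  have hsum := Finset.sum_le_sum fun i (_ : i ∈ univ) =>
    deviation_utility_le_of_welfare_maximizer f hf b hb i (b' i) (fun x => v i x / 2) (hb' i)
      (fun x => by linarith [hv i x])
  have hhalf : ∀ a : ℝ, a - a / 2 = a / 2 := fun a => by ring
  simp only [hhalf]
  linarith
end

section
/- Suppose f' is an exact declared-welfare maximizer over Ω'_feas and the pay-your-bid mechanism M' for the relaxation is (λ,μ)-smooth for deviations to half the value, i.e. for all valuation profiles v and bid profiles b from V, ∑_{i∈N} u'_i(((1/2)·v_i, b_{-i}), v_i) ≥ λ·OPT'(v) − μ·∑_{i∈N} p'_i(b). Let r be an α-approximate oblivious rounding scheme. Then the derived mechanism M is (λ/α,μ)-smooth, witnessed by the deviations b'_i=(1/2)·v_i: for all v, b from V, ∑_{i∈N} U_i(((1/2)·v_i, b_{-i}), v_i) ≥ (λ/α)·max_{x∈Ω} ∑_{i∈N} v_i(x) − μ·∑_{i∈N} P_i(b). -/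
open Finset

/-- If the pay-your-bid mechanism `M'` for the relaxation (with exact
declared-welfare maximizer `f'`) is `(λ, μ)`-smooth for deviations to half the value,
and `r` is an `α`-approximate oblivious rounding scheme, then the derived pay-your-bid
mechanism `M` is `(λ/α, μ)`-smooth, witnessed by the deviations `b'ᵢ = (1/2)·vᵢ`. -/
theorem relax_and_round_half_smooth
    {Γ N : Type*} [Fintype N] [DecidableEq N]
    (F : Set Γ) (Ω : Finset Γ) (hne : Ω.Nonempty) (hΩF : ↑Ω ⊆ F)
    (V : Set (Γ → ℝ)) (hVnn : ∀ w ∈ V, ∀ x, 0 ≤ w x)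
    (hVhalf : ∀ w ∈ V, (fun x => w x / 2) ∈ V)
    (f' : (N → Γ → ℝ) → Γ)
    (hf'F : ∀ b : N → Γ → ℝ, (∀ i, b i ∈ V) → f' b ∈ F)
    (hf'opt : ∀ b : N → Γ → ℝ, (∀ i, b i ∈ V) → ∀ y ∈ F, ∑ i, b i (f' b) ≥ ∑ i, b i y)
    (lam mu : ℝ) (hlam : 0 ≤ lam) (hmu : 0 ≤ mu)
    (hsmooth : ∀ v b : N → Γ → ℝ, (∀ i, v i ∈ V) → (∀ i, b i ∈ V) →
      ∑ i, (v i (f' (Function.update b i (fun x => v i x / 2)))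
            - v i (f' (Function.update b i (fun x => v i x / 2))) / 2)
        ≥ lam * sSup {w : ℝ | ∃ y ∈ F, w = ∑ i, v i y} - mu * ∑ i, b i (f' b))
    (α : ℝ) (hα : 1 ≤ α)
    (r : Γ → Γ → ℝ)
    (hr0 : ∀ x' ∈ F, ∀ x ∈ Ω, 0 ≤ r x' x)
    (hr1 : ∀ x' ∈ F, ∑ x ∈ Ω, r x' x = 1)
    (hobl : ∀ x' ∈ F, ∀ w ∈ V, ∑ x ∈ Ω, r x' x * w x ≥ 1 / α * w x')
    (v b : N → Γ → ℝ) (hv : ∀ i, v i ∈ V) (hb : ∀ i, b i ∈ V) :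
    ∑ i, ∑ x ∈ Ω, r (f' (Function.update b i (fun y => v i y / 2))) x * (v i x - v i x / 2)
      ≥ lam / α * Ω.sup' hne (fun x => ∑ i, v i x)
        - mu * ∑ i, ∑ x ∈ Ω, r (f' b) x * b i x := by
  have hα0 : 0 ≤ 1 / α := by positivity
  have hdev : ∀ i, Function.update b i (fun y => v i y / 2) ∈ Set.univ.pi fun _ : N => V := by
    intro i j _
    rcases eq_or_ne j i with rfl | hji
    · simpa using hVhalf _ (hv j)
    · simpa [hji] using hb j
  have hutil : 1 / α * ∑ i, (v i (f' (Function.update b i (fun x => v i x / 2)))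
        - v i (f' (Function.update b i (fun x => v i x / 2))) / 2)
      ≤ ∑ i, ∑ x ∈ Ω,
          r (f' (Function.update b i (fun y => v i y / 2))) x * (v i x - v i x / 2) := by
    rw [mul_sum]
    refine sum_le_sum fun i _ => ?_
    simpa only [sub_half] using
      hobl _ (hf'F _ fun j => hdev i j (Set.mem_univ j)) _ (hVhalf _ (hv i))
  have hpay : 1 / α * ∑ i, b i (f' b) ≤ ∑ i, ∑ x ∈ Ω, r (f' b) x * b i x := by
    rw [mul_sum]
    exact sum_le_sum fun i _ => hobl _ (hf'F b hb) _ (hb i)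
  have hopt : Ω.sup' hne (fun x => ∑ i, v i x) ≤ sSup {w : ℝ | ∃ y ∈ F, w = ∑ i, v i y} := by
    refine sup'_le _ _ fun x hx => le_csSup ⟨∑ i, v i (f' v), ?_⟩ ⟨x, hΩF hx, rfl⟩
    rintro _ ⟨y, hy, rfl⟩
    exact hf'opt v hv y hy
  calc lam / α * Ω.sup' hne (fun x => ∑ i, v i x) - mu * ∑ i, ∑ x ∈ Ω, r (f' b) x * b i x
      ≤ lam / α * sSup {w : ℝ | ∃ y ∈ F, w = ∑ i, v i y}
          - mu * (1 / α * ∑ i, b i (f' b)) := by gcongr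
    _ = 1 / α * (lam * sSup {w : ℝ | ∃ y ∈ F, w = ∑ i, v i y} - mu * ∑ i, b i (f' b)) := by ring
    _ ≤ _ := (mul_le_mul_of_nonneg_left (hsmooth v b hv hb) hα0).trans hutil
end

section
/- Suppose f' is an exact declared-welfare maximizer over Ω'_feas and the pay-your-bid mechanism M'=(f',p') for the relaxation is (λ,μ)-smooth, i.e. for all valuation profiles v and bid profiles b from V there exists a bid profile b'' from V with ∑_{i∈N} u'_i((b''_i,b_{-i}),v_i) ≥ λ·OPT'(v) − μ·∑_{i∈N} p'_i(b). Let r be an α-approximate oblivious rounding scheme. Then the derived pay-your-bid mechanism M is (λ/(2α),μ)-smooth; in fact the deviations b'_i=(1/2)·v_i witness this: for all v, b from V, ∑_{i∈N} U_i(((1/2)·v_i, b_{-i}), v_i) ≥ (λ/(2α))·max_{x∈Ω} ∑_{i∈N} v_i(x) − μ·∑_{i∈N} P_i(b). -/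
open Finset

/-- For an exact declared-welfare maximizer, bidding half the valuation guarantees at least as
much as half the valuation minus the bid at the outcome of any other unilateral deviation. -/
theorem half_value_sub_bid_le
    {Γ N : Type*} [Fintype N] [DecidableEq N] {F : Set Γ} {V : Set (Γ → ℝ)}
    (hVnn : ∀ w ∈ V, ∀ x, 0 ≤ w x) {f' : (N → Γ → ℝ) → Γ}
    (hf'F : ∀ b : N → Γ → ℝ, (∀ i, b i ∈ V) → f' b ∈ F)
    (hf'opt : ∀ b : N → Γ → ℝ, (∀ i, b i ∈ V) → ∀ y ∈ F, ∑ i, b i (f' b) ≥ ∑ i, b i y)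
    {b : N → Γ → ℝ} (hb : ∀ i, b i ∈ V) {i : N} {h c : Γ → ℝ} (hh : h ∈ V) (hc : c ∈ V) :
    h (f' (Function.update b i c)) - c (f' (Function.update b i c))
      ≤ h (f' (Function.update b i h)) := by
  have mem : ∀ w ∈ V, ∀ j, Function.update b i w j ∈ V := by
    intro w hw j
    rcases eq_or_ne j i with rfl | hj
    · simpa using hw
    · simpa [hj] using hb j
  have split : ∀ (w : Γ → ℝ) (y : Γ),
      ∑ j, Function.update b i w j y = w y + ∑ j ∈ univ.erase i, b j y := by
    intro w y
    rw [← Finset.add_sum_erase univ _ (Finset.mem_univ i), Function.update_self]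
    congr 1
    refine Finset.sum_congr rfl fun j hj => ?_
    rw [Function.update_of_ne (Finset.ne_of_mem_erase hj)]
  have h₁ := hf'opt _ (mem h hh) _ (hf'F _ (mem c hc))
  have h₂ := hf'opt _ (mem c hc) _ (hf'F _ (mem h hh))
  rw [split, split] at h₁ h₂
  linarith [hVnn c hc (f' (Function.update b i h))]

/-- **Main Theorem.** If the pay-your-bid mechanism `M'` for the relaxation
(with exact declared-welfare maximizer `f'`) is `(λ, μ)`-smooth, and `r` is an
`α`-approximate oblivious rounding scheme, then the derived pay-your-bid mechanism `M`
is `(λ/(2α), μ)`-smooth, witnessed by the deviations `b'ᵢ = (1/2)·vᵢ`. -/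
theorem relax_and_round_main
    {Γ N : Type*} [Fintype N] [DecidableEq N]
    (F : Set Γ) (Ω : Finset Γ) (hne : Ω.Nonempty) (hΩF : ↑Ω ⊆ F)
    (V : Set (Γ → ℝ)) (hVnn : ∀ w ∈ V, ∀ x, 0 ≤ w x)
    (hVhalf : ∀ w ∈ V, (fun x => w x / 2) ∈ V)
    (f' : (N → Γ → ℝ) → Γ)
    (hf'F : ∀ b : N → Γ → ℝ, (∀ i, b i ∈ V) → f' b ∈ F)
    (hf'opt : ∀ b : N → Γ → ℝ, (∀ i, b i ∈ V) → ∀ y ∈ F, ∑ i, b i (f' b) ≥ ∑ i, b i y)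
    (lam mu : ℝ) (hlam : 0 ≤ lam) (hmu : 0 ≤ mu)
    (hsmooth : ∀ v b : N → Γ → ℝ, (∀ i, v i ∈ V) → (∀ i, b i ∈ V) →
      ∃ b'' : N → Γ → ℝ, (∀ i, b'' i ∈ V) ∧
        ∑ i, (v i (f' (Function.update b i (b'' i)))
              - b'' i (f' (Function.update b i (b'' i))))
          ≥ lam * sSup {w : ℝ | ∃ y ∈ F, w = ∑ i, v i y} - mu * ∑ i, b i (f' b))
    (α : ℝ) (hα : 1 ≤ α)
    (r : Γ → Γ → ℝ)
    (hr0 : ∀ x' ∈ F, ∀ x ∈ Ω, 0 ≤ r x' x)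
    (hr1 : ∀ x' ∈ F, ∑ x ∈ Ω, r x' x = 1)
    (hobl : ∀ x' ∈ F, ∀ w ∈ V, ∑ x ∈ Ω, r x' x * w x ≥ 1 / α * w x')
    (v b : N → Γ → ℝ) (hv : ∀ i, v i ∈ V) (hb : ∀ i, b i ∈ V) :
    ∑ i, ∑ x ∈ Ω, r (f' (Function.update b i (fun y => v i y / 2))) x * (v i x - v i x / 2)
      ≥ lam / (2 * α) * Ω.sup' hne (fun x => ∑ i, v i x)
        - mu * ∑ i, ∑ x ∈ Ω, r (f' b) x * b i x := by
  have hα0 : 0 < α := by linarith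
  have hhalf : ∀ i, (fun y => v i y / 2) ∈ V := fun i => hVhalf _ (hv i)
  have hupd : ∀ i j, Function.update b i (fun y => v i y / 2) j ∈ V := by
    intro i j
    rcases eq_or_ne j i with rfl | hj
    · simpa using hhalf j
    · simpa [hj] using hb j
  obtain ⟨b'', hb'', hsm⟩ := hsmooth (fun i y => v i y / 2) b hhalf hb
  have hopt : Ω.sup' hne (fun x => ∑ i, v i x) / 2
      ≤ sSup {w : ℝ | ∃ y ∈ F, w = ∑ i, v i y / 2} := by
    obtain ⟨x, hx, hxe⟩ := Finset.exists_mem_eq_sup' hne (fun x => ∑ i, v i x)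
    rw [hxe]
    refine le_csSup ⟨∑ i, v i (f' (fun i y => v i y / 2)) / 2, ?_⟩
      ⟨x, hΩF hx, Finset.sum_div _ _ _⟩
    rintro w ⟨y, hy, rfl⟩
    exact hf'opt _ hhalf y hy
  have hdev : ∑ i, (v i (f' (Function.update b i (b'' i))) / 2
        - b'' i (f' (Function.update b i (b'' i))))
      ≤ ∑ i, v i (f' (Function.update b i (fun y => v i y / 2))) / 2 :=
    Finset.sum_le_sum fun i _ =>
      half_value_sub_bid_le hVnn hf'F hf'opt hb (hhalf i) (hb'' i)
  have hutil : 1 / α * ∑ i, v i (f' (Function.update b i (fun y => v i y / 2))) / 2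
      ≤ ∑ i, ∑ x ∈ Ω, r (f' (Function.update b i (fun y => v i y / 2))) x
          * (v i x - v i x / 2) := by
    rw [Finset.mul_sum]
    refine Finset.sum_le_sum fun i _ => ?_
    simp only [sub_half]
    exact hobl _ (hf'F _ (hupd i)) _ (hhalf i)
  have hpay : 1 / α * ∑ i, b i (f' b) ≤ ∑ i, ∑ x ∈ Ω, r (f' b) x * b i x := by
    rw [Finset.mul_sum]
    exact Finset.sum_le_sum fun i _ => hobl _ (hf'F b hb) _ (hb i)
  have hrelax : lam * (Ω.sup' hne (fun x => ∑ i, v i x) / 2) - mu * ∑ i, b i (f' b)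
      ≤ ∑ i, v i (f' (Function.update b i (fun y => v i y / 2))) / 2 := by
    linarith [mul_le_mul_of_nonneg_left hopt hlam]
  have hscaled := mul_le_mul_of_nonneg_left hrelax (one_div_nonneg.mpr hα0.le)
  have hpay' := mul_le_mul_of_nonneg_left hpay hmu
  calc _ ≤ lam / (2 * α) * Ω.sup' hne (fun x => ∑ i, v i x)
        - mu * (1 / α * ∑ i, b i (f' b)) := by linarith
    _ = 1 / α * (lam * (Ω.sup' hne (fun x => ∑ i, v i x) / 2)
        - mu * ∑ i, b i (f' b)) := by
      field_simp
    _ ≤ _ := hscaled.trans hutil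
end

section
/- Let M=(f,p) be a pay-your-bid mechanism that is (λ,μ)-smooth with λ > 0. Let v be a valuation profile and b a bid profile that is a pure Nash equilibrium under v (for every agent i and every bid b'_i, u_i(b,v_i) ≥ u_i((b'_i,b_{-i}),v_i)) and at which every agent has nonnegative utility (u_i(b,v_i) ≥ 0 for all i∈N). Then ∑_{i∈N} v_i(f(b)) ≥ (λ/max(μ,1))·OPT(v). -/
open Finset

/-- (Pure-Nash, pay-your-bid instance of the Syrgkanis–Tardos smoothness
theorem.) If the pay-your-bid mechanism `M = (f, p)` is `(λ, μ)`-smooth with `λ > 0`,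
`b` is a pure Nash equilibrium under valuations `v` at which every agent has nonnegative
utility, then the welfare of `f b` is at least `λ / max μ 1` times the optimal welfare. -/
theorem smooth_pure_nash_poa
    {Ω N : Type*} [Fintype Ω] [Nonempty Ω] [Fintype N] [DecidableEq N]
    (f : (N → Ω → ℝ) → Ω)
    (lam mu : ℝ) (hlam : 0 < lam) (hmu : 0 ≤ mu)
    (hsmooth : ∀ v b : N → Ω → ℝ, (∀ i x, 0 ≤ v i x) → (∀ i x, 0 ≤ b i x) →
      ∃ b' : N → Ω → ℝ, (∀ i x, 0 ≤ b' i x) ∧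
        ∑ i, (v i (f (Function.update b i (b' i))) - b' i (f (Function.update b i (b' i))))
          ≥ lam * univ.sup' univ_nonempty (fun x => ∑ i, v i x) - mu * ∑ i, b i (f b))
    (v b : N → Ω → ℝ) (hv : ∀ i x, 0 ≤ v i x) (hb : ∀ i x, 0 ≤ b i x)
    (hNash : ∀ (i : N) (b' : Ω → ℝ), (∀ x, 0 ≤ b' x) →
      v i (f b) - b i (f b)
        ≥ v i (f (Function.update b i b')) - b' (f (Function.update b i b')))
    (hIR : ∀ i, 0 ≤ v i (f b) - b i (f b)) :
    ∑ i, v i (f b) ≥ lam / max mu 1 * univ.sup' univ_nonempty (fun x => ∑ i, v i x) := by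
  obtain ⟨b', hb', hdev⟩ := hsmooth v b hv hb
  have hutil := hdev.le.trans (sum_le_sum fun i _ => hNash i (b' i) (hb' i))
  rw [sum_sub_distrib] at hutil
  have hpay : ∑ i, b i (f b) ≤ ∑ i, v i (f b) :=
    sum_le_sum fun i _ => sub_nonneg.mp (hIR i)
  have hpay_nonneg : 0 ≤ ∑ i, b i (f b) := sum_nonneg fun i _ => hb i (f b)
  have hmax_pos : 0 < max mu 1 := lt_max_of_lt_right one_pos
  rw [ge_iff_le, div_mul_eq_mul_div, div_le_iff₀ hmax_pos]
  have hrevenue := mul_le_mul_of_nonneg_right (le_max_left mu 1) hpay_nonneg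
  have hslack := mul_le_mul_of_nonneg_left hpay (sub_nonneg.mpr (le_max_right mu 1))
  linarith
end

section
/- Let x̄ be any fractional solution feasible for capacities c of a d-sparse packing integer program. Then ∑_{i∈N} ( W^{b_{-i}}(c) − W^{b_{-i}}(c − A(x̄_i,0)) ) ≤ (d+1)·W^{b}(c). -/
open Finset

/-- A fractional solution of a packing integer program, feasible for capacities `c`. -/
def PIPFeasible {N K L : Type*} [Fintype N] [Fintype K] [Fintype L]
    (A : L → N → K → ℝ) (c : L → ℝ) (x : N → K → ℝ) : Prop :=
  (∀ i k, 0 ≤ x i k) ∧ (∀ i, ∑ k, x i k ≤ 1) ∧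
    ∀ ℓ, ∑ i, ∑ k, A ℓ i k * x i k ≤ c ℓ

/-- `pipW A b c` is the optimal declared welfare `W^b(c)` of the LP relaxation:
the supremum of `∑ i ∑ k b i k * x i k` over fractional solutions feasible for `c`. -/
noncomputable def pipW {N K L : Type*} [Fintype N] [Fintype K] [Fintype L]
    (A : L → N → K → ℝ) (b : N → K → ℝ) (c : L → ℝ) : ℝ :=
  sSup {w : ℝ | ∃ x : N → K → ℝ, PIPFeasible A c x ∧ w = ∑ i, ∑ k, b i k * x i k}

theorem PIPFeasible.bddAbove_welfare {N K L : Type*} [Fintype N] [Fintype K] [Fintype L]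
    (A : L → N → K → ℝ) (b : N → K → ℝ) (hb : ∀ i k, 0 ≤ b i k) (c : L → ℝ) :
    BddAbove {w : ℝ | ∃ x : N → K → ℝ, PIPFeasible A c x ∧ w = ∑ i, ∑ k, b i k * x i k} := by
  refine ⟨∑ i, ∑ k, b i k, ?_⟩
  rintro w ⟨x, hx, rfl⟩
  refine sum_le_sum fun i _ => sum_le_sum fun k _ => ?_
  have hx1 : x i k ≤ 1 :=
    (single_le_sum (f := fun k => x i k) (fun k _ => hx.1 i k) (mem_univ k)).trans (hx.2.1 i)
  exact mul_le_of_le_one_right (hb i k) hx1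

theorem PIPFeasible.welfare_le_pipW {N K L : Type*} [Fintype N] [Fintype K] [Fintype L]
    {A : L → N → K → ℝ} {b : N → K → ℝ} (hb : ∀ i k, 0 ≤ b i k) {c : L → ℝ}
    {x : N → K → ℝ} (hx : PIPFeasible A c x) :
    ∑ i, ∑ k, b i k * x i k ≤ pipW A b c :=
  le_csSup (PIPFeasible.bddAbove_welfare A b hb c) ⟨x, hx, rfl⟩

theorem pipW_mono {N K L : Type*} [Fintype N] [Fintype K] [Fintype L]
    {A : L → N → K → ℝ} {b b' : N → K → ℝ} (hb' : ∀ i k, 0 ≤ b' i k)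
    (h : ∀ i k, b i k ≤ b' i k) {c : L → ℝ} {x : N → K → ℝ} (hx : PIPFeasible A c x) :
    pipW A b c ≤ pipW A b' c := by
  refine csSup_le ⟨_, x, hx, rfl⟩ ?_
  rintro w ⟨y, hy, rfl⟩
  refine le_trans ?_ (hy.welfare_le_pipW hb')
  exact sum_le_sum fun i _ => sum_le_sum fun k _ => mul_le_mul_of_nonneg_right (h i k) (hy.1 i k)

/-- Scaling each coordinate of `x` by the positive part of `1 - ∑ a ℓ / c ℓ`, the sum running over
the constraints involving that coordinate, makes `x` feasible for the capacities `c - a`. -/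
theorem PIPFeasible.scaled_welfare_le_pipW {N K L : Type*} [Fintype N] [Fintype K] [Fintype L]
    {A : L → N → K → ℝ} (hA : ∀ ℓ i k, 0 ≤ A ℓ i k) {b : N → K → ℝ} (hb : ∀ i k, 0 ≤ b i k)
    {c a : L → ℝ} (hc : ∀ ℓ, 0 < c ℓ) (ha : ∀ ℓ, 0 ≤ a ℓ) (hac : ∀ ℓ, a ℓ ≤ c ℓ)
    {x : N → K → ℝ} (hx : PIPFeasible A c x) :
    ∑ i, ∑ k, b i k * (x i k * (1 - ∑ ℓ with A ℓ i k ≠ 0, a ℓ / c ℓ))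
      ≤ pipW A b (fun ℓ => c ℓ - a ℓ) := by
  have hr : ∀ ℓ, 0 ≤ a ℓ / c ℓ := fun ℓ => div_nonneg (ha ℓ) (hc ℓ).le
  have hr1 : ∀ ℓ, a ℓ / c ℓ ≤ 1 := fun ℓ => (div_le_one (hc ℓ)).2 (hac ℓ)
  set t : N → K → ℝ := fun i k => max 0 (1 - ∑ ℓ with A ℓ i k ≠ 0, a ℓ / c ℓ) with ht
  have ht0 : ∀ i k, 0 ≤ t i k := fun i k => le_max_left _ _
  have ht1 : ∀ i k, t i k ≤ 1 := fun i k =>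
    max_le zero_le_one (sub_le_self _ (sum_nonneg fun ℓ _ => hr ℓ))
  have htr : ∀ ℓ i k, A ℓ i k ≠ 0 → t i k ≤ 1 - a ℓ / c ℓ := fun ℓ i k h => by
    refine max_le (sub_nonneg.2 (hr1 ℓ)) (sub_le_sub_left ?_ _)
    exact single_le_sum (f := fun ℓ => a ℓ / c ℓ) (fun m _ => hr m) (by simpa using h)
  have hfeas : PIPFeasible A (fun ℓ => c ℓ - a ℓ) (fun i k => x i k * t i k) := by
    refine ⟨fun i k => mul_nonneg (hx.1 i k) (ht0 i k), fun i => ?_, fun ℓ => ?_⟩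
    · exact (sum_le_sum fun k _ => mul_le_of_le_one_right (hx.1 i k) (ht1 i k)).trans (hx.2.1 i)
    · calc ∑ i, ∑ k, A ℓ i k * (x i k * t i k)
          ≤ ∑ i, ∑ k, A ℓ i k * x i k * (1 - a ℓ / c ℓ) := by
            refine sum_le_sum fun i _ => sum_le_sum fun k _ => ?_
            by_cases h : A ℓ i k = 0
            · simp [h]
            · rw [← mul_assoc]
              exact mul_le_mul_of_nonneg_left (htr ℓ i k h) (mul_nonneg (hA ℓ i k) (hx.1 i k))
        _ = (∑ i, ∑ k, A ℓ i k * x i k) * (1 - a ℓ / c ℓ) := by simp only [sum_mul]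
        _ ≤ c ℓ * (1 - a ℓ / c ℓ) :=
            mul_le_mul_of_nonneg_right (hx.2.2 ℓ) (sub_nonneg.2 (hr1 ℓ))
        _ = c ℓ - a ℓ := by
            have := (hc ℓ).ne'
            field_simp
  refine le_trans ?_ (hfeas.welfare_le_pipW hb)
  refine sum_le_sum fun i _ => sum_le_sum fun k _ => ?_
  exact mul_le_mul_of_nonneg_left (mul_le_mul_of_nonneg_left (le_max_right _ _) (hx.1 i k)) (hb i k)

/-- **Lemma 3 of the paper.** For a `d`-sparse packing integer program and
any feasible fractional solution `x̄`,
`∑ i (W^{b₋ᵢ}(c) − W^{b₋ᵢ}(c − A(x̄ᵢ,0))) ≤ (d+1)·W^b(c)`. -/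
theorem pip_net_loss_bound
    {N K L : Type*} [Fintype N] [Fintype K] [Fintype L] [DecidableEq N]
    (d : ℕ) (A : L → N → K → ℝ) (hA : ∀ ℓ i k, 0 ≤ A ℓ i k)
    (hd : ∀ i k, (univ.filter fun ℓ => A ℓ i k ≠ 0).card ≤ d)
    (c : L → ℝ) (hc : ∀ ℓ, 0 < c ℓ)
    (b : N → K → ℝ) (hb : ∀ i k, 0 ≤ b i k)
    (xbar : N → K → ℝ) (hxbar : PIPFeasible A c xbar) :
    ∑ i, (pipW A (Function.update b i 0) c
          - pipW A (Function.update b i 0) (fun ℓ => c ℓ - ∑ k, A ℓ i k * xbar i k))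
      ≤ ((d : ℝ) + 1) * pipW A b c := by
  set a : N → L → ℝ := fun i ℓ => ∑ k, A ℓ i k * xbar i k with ha_def
  have ha : ∀ i ℓ, 0 ≤ a i ℓ := fun i ℓ =>
    sum_nonneg fun k _ => mul_nonneg (hA ℓ i k) (hxbar.1 i k)
  have hsum : ∀ ℓ, ∑ i, a i ℓ ≤ c ℓ := hxbar.2.2
  have hac : ∀ i ℓ, a i ℓ ≤ c ℓ := fun i ℓ =>
    (single_le_sum (f := fun i => a i ℓ) (fun j _ => ha j ℓ) (mem_univ i)).trans (hsum ℓ)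
  have hupd : ∀ i j k, 0 ≤ Function.update b i 0 j k ∧ Function.update b i 0 j k ≤ b j k := by
    intro i j k
    obtain rfl | h := eq_or_ne j i
    · simpa using hb j k
    · simpa [h] using hb j k
  have hloss : ∀ x, PIPFeasible A c x →
      ∑ i, (pipW A (Function.update b i 0) c
          - pipW A (Function.update b i 0) (fun ℓ => c ℓ - a i ℓ))
        ≤ Fintype.card N * (pipW A b c - ∑ i, ∑ k, b i k * x i k)
          + (d + 1) * ∑ i, ∑ k, b i k * x i k := by
    intro x hx
    have hbx : ∀ j k, 0 ≤ b j k * x j k := fun j k => mul_nonneg (hb j k) (hx.1 j k)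
    have hkey : ∀ i, pipW A (Function.update b i 0) c
          - pipW A (Function.update b i 0) (fun ℓ => c ℓ - a i ℓ)
        ≤ (pipW A b c - ∑ i, ∑ k, b i k * x i k) + (∑ k, b i k * x i k
          + ∑ j, ∑ k, b j k * x j k * ∑ ℓ with A ℓ j k ≠ 0, a i ℓ / c ℓ) := by
      intro i
      have h1 : pipW A (Function.update b i 0) c ≤ pipW A b c :=
        pipW_mono hb (fun j k => (hupd i j k).2) hx
      have h2 := hx.scaled_welfare_le_pipW hA (fun j k => (hupd i j k).1) hc (ha i) (hac i)
      have h3 : ∑ j, ∑ k, b j k * x j k - ∑ k, b i k * x i k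
          - ∑ j, ∑ k, b j k * x j k * ∑ ℓ with A ℓ j k ≠ 0, a i ℓ / c ℓ
          ≤ ∑ j, ∑ k, Function.update b i 0 j k *
            (x j k * (1 - ∑ ℓ with A ℓ j k ≠ 0, a i ℓ / c ℓ)) := by
        have h4 : ∑ k, b i k * x i k = ∑ j, if j = i then ∑ k, b j k * x j k else 0 := by simp
        rw [h4, ← sum_sub_distrib, ← sum_sub_distrib]
        refine sum_le_sum fun j _ => ?_
        obtain rfl | h := eq_or_ne j i
        · simp only [if_true, sub_self, zero_sub, Function.update_self, Pi.zero_apply, zero_mul,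
            sum_const_zero, Left.neg_nonpos_iff]
          exact sum_nonneg fun k _ => mul_nonneg (hbx j k)
            (sum_nonneg fun ℓ _ => div_nonneg (ha j ℓ) (hc ℓ).le)
        · rw [if_neg h, sub_zero, ← sum_sub_distrib, Function.update_of_ne h]
          exact le_of_eq (sum_congr rfl fun k _ => by ring)
      linarith
    have hratio : ∀ j k, ∑ i, ∑ ℓ with A ℓ j k ≠ 0, a i ℓ / c ℓ ≤ d := by
      intro j k
      rw [sum_comm]
      calc ∑ ℓ with A ℓ j k ≠ 0, ∑ i, a i ℓ / c ℓ
          ≤ ∑ ℓ with A ℓ j k ≠ 0, (1 : ℝ) := by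
            refine sum_le_sum fun ℓ _ => ?_
            rw [← sum_div]
            exact (div_le_one (hc ℓ)).2 (hsum ℓ)
        _ ≤ d := by
            rw [sum_const, nsmul_eq_mul, mul_one]
            exact_mod_cast hd j k
    have hscale : ∑ i, ∑ j, ∑ k, b j k * x j k * ∑ ℓ with A ℓ j k ≠ 0, a i ℓ / c ℓ
        ≤ d * ∑ j, ∑ k, b j k * x j k := by
      rw [sum_comm, mul_sum]
      refine sum_le_sum fun j _ => ?_
      rw [sum_comm, mul_sum]
      refine sum_le_sum fun k _ => ?_
      rw [← mul_sum, mul_comm]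
      exact mul_le_mul_of_nonneg_right (hratio j k) (hbx j k)
    refine (sum_le_sum fun i _ => hkey i).trans ?_
    rw [sum_add_distrib, sum_add_distrib, sum_const, nsmul_eq_mul, card_univ]
    linarith
  refine le_of_forall_pos_le_add fun ε hε => ?_
  have hn : (0 : ℝ) < Fintype.card N + 1 := by positivity
  obtain ⟨_, ⟨x, hx, rfl⟩, hlt⟩ := exists_lt_of_lt_csSup
    (s := {w : ℝ | ∃ x : N → K → ℝ, PIPFeasible A c x ∧ w = ∑ i, ∑ k, b i k * x i k})
    ⟨_, xbar, hxbar, rfl⟩ (sub_lt_self (pipW A b c) (div_pos hε hn))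
  have hle := hx.welfare_le_pipW hb
  have hgap : pipW A b c - ∑ i, ∑ k, b i k * x i k ≤ ε / (Fintype.card N + 1) := by linarith
  have h1 : Fintype.card N * (pipW A b c - ∑ i, ∑ k, b i k * x i k) ≤ ε := by
    have := (le_div_iff₀ hn).1 hgap
    linarith
  have h2 : ((d : ℝ) + 1) * ∑ i, ∑ k, b i k * x i k ≤ (d + 1) * pipW A b c :=
    mul_le_mul_of_nonneg_left hle (by positivity)
  linarith [hloss x hx]
end

section
/- The pay-your-bid mechanism that solves the canonical LP relaxation of a d-sparse packing integer program exactly is (1/2, d+1)-smooth for deviations to half the value: for all nonnegative valuation values v=(v_{i,k}) and bid values b=(b_{i,k}), with deviations b'_i = (1/2)·v_i, ∑_{i∈N} ∑_{k∈K} (v_{i,k} − b'_{i,k})·x̂(b'_i,b_{-i})_{i,k} ≥ (1/2)·W^{v}(c) − (d+1)·∑_{i∈N} ∑_{k∈K} b_{i,k}·x̂(b)_{i,k}. -/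
open Finset

theorem sum_update_eq_add_sum_erase {N β : Type*} [Fintype N] [DecidableEq N]
    (P : N → β → ℝ) (u : N → β) (i : N) (a : β) :
    ∑ j, P j (Function.update u i a j) = P i a + ∑ j ∈ univ.erase i, P j (u j) := by
  rw [← Finset.add_sum_erase univ _ (mem_univ i), Function.update_self]
  congr 1
  refine Finset.sum_congr rfl fun j hj => ?_
  rw [Function.update_of_ne (Finset.ne_of_mem_erase hj)]

/-- The fraction of the capacity of constraint `ℓ` that bidder `i` uses under `y`. -/
noncomputable def pipLoad {N K L : Type*} [Fintype K]
    (A : L → N → K → ℝ) (c : L → ℝ) (y : N → K → ℝ) (i : N) (ℓ : L) : ℝ :=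
  (∑ k, A ℓ i k * y i k) / c ℓ

/-- The total load that bidder `i` puts under `y` on the constraints in which bidder `j`
participates with option `k`. -/
noncomputable def pipConflict {N K L : Type*} [Fintype K] [Fintype L]
    (A : L → N → K → ℝ) (c : L → ℝ) (y : N → K → ℝ) (i j : N) (k : K) : ℝ :=
  ∑ ℓ with A ℓ j k ≠ 0, pipLoad A c y i ℓ

section

variable {N K L : Type*} [Fintype N] [Fintype K] [Fintype L]
  {A : L → N → K → ℝ} {c : L → ℝ} {x y : N → K → ℝ}

theorem pipLoad_nonneg (hA : ∀ ℓ i k, 0 ≤ A ℓ i k) (hc : ∀ ℓ, 0 < c ℓ)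
    (hy : PIPFeasible A c y) (i : N) (ℓ : L) : 0 ≤ pipLoad A c y i ℓ :=
  div_nonneg (Finset.sum_nonneg fun k _ => mul_nonneg (hA ℓ i k) (hy.1 i k)) (hc ℓ).le

theorem sum_pipLoad_le_one (hc : ∀ ℓ, 0 < c ℓ) (hy : PIPFeasible A c y) (ℓ : L) :
    ∑ i, pipLoad A c y i ℓ ≤ 1 := by
  simp only [pipLoad]
  rw [← Finset.sum_div, div_le_one (hc ℓ)]
  exact hy.2.2 ℓ

theorem pipLoad_le_one (hA : ∀ ℓ i k, 0 ≤ A ℓ i k) (hc : ∀ ℓ, 0 < c ℓ)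
    (hy : PIPFeasible A c y) (i : N) (ℓ : L) : pipLoad A c y i ℓ ≤ 1 :=
  (Finset.single_le_sum (fun j _ => pipLoad_nonneg hA hc hy j ℓ) (mem_univ i)).trans
    (sum_pipLoad_le_one hc hy ℓ)

theorem pipConflict_nonneg (hA : ∀ ℓ i k, 0 ≤ A ℓ i k) (hc : ∀ ℓ, 0 < c ℓ)
    (hy : PIPFeasible A c y) (i j : N) (k : K) : 0 ≤ pipConflict A c y i j k :=
  Finset.sum_nonneg fun ℓ _ => pipLoad_nonneg hA hc hy i ℓ

theorem sum_pipConflict_le {d : ℕ} (hc : ∀ ℓ, 0 < c ℓ)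
    (hd : ∀ i k, (univ.filter fun ℓ => A ℓ i k ≠ 0).card ≤ d)
    (hy : PIPFeasible A c y) (j : N) (k : K) : ∑ i, pipConflict A c y i j k ≤ d := by
  simp only [pipConflict]
  rw [Finset.sum_comm]
  calc ∑ ℓ with A ℓ j k ≠ 0, ∑ i, pipLoad A c y i ℓ
      ≤ ∑ ℓ with A ℓ j k ≠ 0, (1 : ℝ) :=
        Finset.sum_le_sum fun ℓ _ => sum_pipLoad_le_one hc hy ℓ
    _ ≤ d := by
        rw [Finset.sum_const, nsmul_one]
        exact_mod_cast hd j k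

variable [DecidableEq N]

/-- Bidder `i` can be given its share under `y` if all other shares under `x` are reduced
in proportion to their conflict with bidder `i`. -/
theorem PIPFeasible.update (hA : ∀ ℓ i k, 0 ≤ A ℓ i k) (hc : ∀ ℓ, 0 < c ℓ)
    (hx : PIPFeasible A c x) (hy : PIPFeasible A c y) (i : N) :
    PIPFeasible A c (Function.update
      (fun j k => x j k * max 0 (1 - pipConflict A c y i j k)) i (y i)) := by
  have hm1 : ∀ j k, max 0 (1 - pipConflict A c y i j k) ≤ 1 := fun j k =>
    max_le zero_le_one (by linarith [pipConflict_nonneg hA hc hy i j k])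
  refine ⟨fun j k => ?_, fun j => ?_, fun ℓ => ?_⟩
  · rcases eq_or_ne j i with rfl | h
    · simpa using hy.1 j k
    · rw [Function.update_of_ne h]
      exact mul_nonneg (hx.1 j k) (le_max_left _ _)
  · rcases eq_or_ne j i with rfl | h
    · simpa using hy.2.1 j
    · rw [Function.update_of_ne h]
      exact (Finset.sum_le_sum fun k _ =>
        mul_le_of_le_one_right (hx.1 j k) (hm1 j k)).trans (hx.2.1 j)
  · rw [sum_update_eq_add_sum_erase (fun j (u : K → ℝ) => ∑ k, A ℓ j k * u k)]
    have hload : ∑ k, A ℓ i k * y i k = pipLoad A c y i ℓ * c ℓ :=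
      (div_mul_cancel₀ _ (hc ℓ).ne').symm
    have hle1 := pipLoad_le_one hA hc hy i ℓ
    have hterm : ∀ j k, A ℓ j k * (x j k * max 0 (1 - pipConflict A c y i j k))
        ≤ (1 - pipLoad A c y i ℓ) * (A ℓ j k * x j k) := by
      intro j k
      by_cases h : A ℓ j k = 0
      · simp [h]
      have hmem : pipLoad A c y i ℓ ≤ pipConflict A c y i j k :=
        Finset.single_le_sum (f := fun ℓ => pipLoad A c y i ℓ)
          (fun ℓ' _ => pipLoad_nonneg hA hc hy i ℓ') (by simpa using h)
      calc A ℓ j k * (x j k * max 0 (1 - pipConflict A c y i j k))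
          = max 0 (1 - pipConflict A c y i j k) * (A ℓ j k * x j k) := by ring
        _ ≤ _ := mul_le_mul_of_nonneg_right
            (max_le (by linarith) (by linarith)) (mul_nonneg (hA ℓ j k) (hx.1 j k))
    have hrest : ∑ j ∈ univ.erase i,
        ∑ k, A ℓ j k * (x j k * max 0 (1 - pipConflict A c y i j k))
        ≤ (1 - pipLoad A c y i ℓ) * c ℓ := by
      calc _ ≤ ∑ j, ∑ k, A ℓ j k * (x j k * max 0 (1 - pipConflict A c y i j k)) :=
            Finset.sum_le_sum_of_subset_of_nonneg (Finset.erase_subset _ _) fun j _ _ =>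
              Finset.sum_nonneg fun k _ => mul_nonneg (hA ℓ j k)
                (mul_nonneg (hx.1 j k) (le_max_left _ _))
        _ ≤ ∑ j, ∑ k, (1 - pipLoad A c y i ℓ) * (A ℓ j k * x j k) :=
            Finset.sum_le_sum fun j _ => Finset.sum_le_sum fun k _ => hterm j k
        _ = (1 - pipLoad A c y i ℓ) * ∑ j, ∑ k, A ℓ j k * x j k := by
            simp only [Finset.mul_sum]
        _ ≤ _ := mul_le_mul_of_nonneg_left (hx.2.2 ℓ) (by linarith)
    linarith

/-- If `z` is optimal after bidder `i` changes its bid to `a`, and `x` is optimal before, then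
the declared value of bidder `i` under `z` is at least its declared value under `y` minus
the bids that `y i` displaces. -/
theorem deviation_value_ge (hA : ∀ ℓ i k, 0 ≤ A ℓ i k) (hc : ∀ ℓ, 0 < c ℓ)
    (hx : PIPFeasible A c x) (hy : PIPFeasible A c y)
    {b z : N → K → ℝ} (hb : ∀ i k, 0 ≤ b i k) (hz : PIPFeasible A c z)
    (hxopt : ∀ w, PIPFeasible A c w → ∑ j, ∑ k, b j k * w j k ≤ ∑ j, ∑ k, b j k * x j k)
    (i : N) (a : K → ℝ)
    (hzopt : ∀ w, PIPFeasible A c w → ∑ j, ∑ k, Function.update b i a j k * w j k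
      ≤ ∑ j, ∑ k, Function.update b i a j k * z j k) :
    ∑ k, a k * y i k - ∑ k, b i k * x i k
      - ∑ j, ∑ k, b j k * x j k * pipConflict A c y i j k ≤ ∑ k, a k * z i k := by
  have hopt := hzopt _ (hx.update hA hc hy i)
  rw [sum_update_eq_add_sum_erase (fun j (u : K → ℝ) => ∑ k, u k * Function.update
      (fun j k => x j k * max 0 (1 - pipConflict A c y i j k)) i (y i) j k),
    sum_update_eq_add_sum_erase (fun j (u : K → ℝ) => ∑ k, u k * z j k),
    Function.update_self] at hopt
  have hz' := hxopt z hz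
  rw [← Finset.add_sum_erase univ _ (mem_univ i),
    ← Finset.add_sum_erase univ (fun j => ∑ k, b j k * x j k) (mem_univ i)] at hz'
  have hzi : 0 ≤ ∑ k, b i k * z i k :=
    Finset.sum_nonneg fun k _ => mul_nonneg (hb i k) (hz.1 i k)
  have hconf : ∑ j ∈ univ.erase i, ∑ k, b j k * x j k * pipConflict A c y i j k
      ≤ ∑ j, ∑ k, b j k * x j k * pipConflict A c y i j k :=
    Finset.sum_le_sum_of_subset_of_nonneg (Finset.erase_subset _ _) fun j _ _ =>
      Finset.sum_nonneg fun k _ => mul_nonneg (mul_nonneg (hb j k) (hx.1 j k))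
        (pipConflict_nonneg hA hc hy i j k)
  have hkeep : ∑ j ∈ univ.erase i, ∑ k, b j k * x j k
      - ∑ j ∈ univ.erase i, ∑ k, b j k * x j k * pipConflict A c y i j k
      ≤ ∑ j ∈ univ.erase i, ∑ k, b j k * Function.update
        (fun j k => x j k * max 0 (1 - pipConflict A c y i j k)) i (y i) j k := by
    simp only [← Finset.sum_sub_distrib]
    refine Finset.sum_le_sum fun j hj => Finset.sum_le_sum fun k _ => ?_
    rw [Function.update_of_ne (Finset.ne_of_mem_erase hj)]
    nlinarith [mul_le_mul_of_nonneg_left (le_max_right 0 (1 - pipConflict A c y i j k))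
      (mul_nonneg (hb j k) (hx.1 j k))]
  linarith

end

/-- **Lemma 2 of the paper.** The pay-your-bid mechanism that solves the
canonical LP relaxation of a `d`-sparse packing integer program exactly is
`(1/2, d+1)`-smooth for deviations to half the value. -/
theorem pip_mechanism_half_smooth
    {N K L : Type*} [Fintype N] [Fintype K] [Fintype L] [DecidableEq N]
    (d : ℕ) (A : L → N → K → ℝ) (hA : ∀ ℓ i k, 0 ≤ A ℓ i k)
    (hd : ∀ i k, (univ.filter fun ℓ => A ℓ i k ≠ 0).card ≤ d)
    (c : L → ℝ) (hc : ∀ ℓ, 0 < c ℓ)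
    (xhat : (N → K → ℝ) → (N → K → ℝ))
    (hfeas : ∀ b : N → K → ℝ, (∀ i k, 0 ≤ b i k) → PIPFeasible A c (xhat b))
    (hopt : ∀ b : N → K → ℝ, (∀ i k, 0 ≤ b i k) → ∀ y : N → K → ℝ, PIPFeasible A c y →
      ∑ i, ∑ k, b i k * xhat b i k ≥ ∑ i, ∑ k, b i k * y i k)
    (v b : N → K → ℝ) (hv : ∀ i k, 0 ≤ v i k) (hb : ∀ i k, 0 ≤ b i k) :
    ∑ i, ∑ k, (v i k - v i k / 2) * xhat (Function.update b i (fun k => v i k / 2)) i k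
      ≥ 1 / 2 * pipW A v c - ((d : ℝ) + 1) * ∑ i, ∑ k, b i k * xhat b i k := by
  have hx := hfeas b hb
  suffices h : pipW A v c ≤ 2 * (∑ i, ∑ k, (v i k - v i k / 2) *
      xhat (Function.update b i (fun k => v i k / 2)) i k
      + ((d : ℝ) + 1) * ∑ i, ∑ k, b i k * xhat b i k) by linarith
  refine csSup_le ⟨_, xhat b, hx, rfl⟩ ?_
  rintro _ ⟨y, hy, rfl⟩
  have hdev : ∀ i, ∑ k, v i k / 2 * y i k - ∑ k, b i k * xhat b i k
      - ∑ j, ∑ k, b j k * xhat b j k * pipConflict A c y i j k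
      ≤ ∑ k, v i k / 2 * xhat (Function.update b i (fun k => v i k / 2)) i k := by
    intro i
    have hb' : ∀ j k, 0 ≤ Function.update b i (fun k => v i k / 2) j k := by
      intro j k
      rcases eq_or_ne j i with rfl | h
      · rw [Function.update_self]
        exact div_nonneg (hv j k) zero_le_two
      · simpa [Function.update_of_ne h] using hb j k
    exact deviation_value_ge hA hc hx hy hb (hfeas _ hb') (hopt b hb) i _ (hopt _ hb')
  have hsum := Finset.sum_le_sum fun i (_ : i ∈ univ) => hdev i
  simp only [Finset.sum_sub_distrib] at hsum
  have hconf : ∑ i, ∑ j, ∑ k, b j k * xhat b j k * pipConflict A c y i j k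
      ≤ d * ∑ j, ∑ k, b j k * xhat b j k := by
    rw [Finset.sum_comm, Finset.mul_sum]
    refine Finset.sum_le_sum fun j _ => ?_
    rw [Finset.sum_comm, Finset.mul_sum]
    refine Finset.sum_le_sum fun k _ => ?_
    rw [← Finset.mul_sum, mul_comm (d : ℝ)]
    exact mul_le_mul_of_nonneg_left (sum_pipConflict_le hc hd hy j k)
      (mul_nonneg (hb j k) (hx.1 j k))
  have hhalf : ∑ i, ∑ k, v i k / 2 * y i k = (∑ i, ∑ k, v i k * y i k) / 2 := by
    simp only [Finset.sum_div, div_mul_eq_mul_div]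
  simp only [sub_half]
  linarith
end

section
/- Let n ≥ 4 and m = n−2, and consider the multi-unit auction with n bidders and m units. Define valuations v by: for i ∈ {1,…,m}, v_i(k)=1 for all 1 ≤ k ≤ m and v_i(0)=0; for i ∈ {n−1,n}, v_i(k)=0 for 0 ≤ k < m and v_i(m)=2. Define bids b by: b_i = 0 for i ∈ {1,…,m}, and b_i = v_i for i ∈ {n−1,n}. Then for every exact declared-welfare maximizer f: (i) b is a pure Nash equilibrium of the pay-your-bid mechanism (f,p) under valuations v, (ii) ∑_{i} v_i(f(b)_i) = 2, and (iii) max over allocations x of ∑_i v_i(x_i) equals m. Hence the welfare at this equilibrium is a factor m/2 = (n−2)/2 below the optimal welfare. -/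
open Finset

/-- The valuations of the multi-unit auction instance of Proposition 1: the first `m`
bidders have value `1` for any positive number of units, and the remaining (two) bidders
have value `2` for exactly `m` units and `0` otherwise. -/
noncomputable def muaV (n m : ℕ) : Fin n → ℕ → ℝ := fun i k =>
  if (i : ℕ) < m then (if k = 0 then 0 else 1) else (if k = m then 2 else 0)

/-- The equilibrium bids of the multi-unit auction instance of Proposition 1: the first
`m` bidders bid `0` and the remaining (two) bidders bid truthfully. -/
noncomputable def muaB (n m : ℕ) : Fin n → ℕ → ℝ := fun i k =>
  if (i : ℕ) < m then 0 else muaV n m i k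

theorem muaV_nonneg (n m : ℕ) (i : Fin n) (k : ℕ) : 0 ≤ muaV n m i k := by
  unfold muaV; split_ifs <;> norm_num

theorem muaV_zero {n m : ℕ} (hm : m ≠ 0) (i : Fin n) : muaV n m i 0 = 0 := by
  simp [muaV, hm.symm]

theorem muaV_le_two (n m : ℕ) (i : Fin n) (k : ℕ) : muaV n m i k ≤ 2 := by
  unfold muaV; split_ifs <;> norm_num

theorem muaV_le_cast {n m : ℕ} (hm : 2 ≤ m) (i : Fin n) (k : ℕ) : muaV n m i k ≤ k := by
  unfold muaV
  split_ifs with _ hk hk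
  · simp
  · exact_mod_cast Nat.one_le_iff_ne_zero.mpr hk
  · subst hk; exact_mod_cast hm
  · simp

theorem muaB_nonneg (n m : ℕ) (i : Fin n) (k : ℕ) : 0 ≤ muaB n m i k := by
  unfold muaB
  split_ifs
  exacts [le_rfl, muaV_nonneg n m i k]

theorem muaB_le_muaV (n m : ℕ) (i : Fin n) (k : ℕ) : muaB n m i k ≤ muaV n m i k := by
  unfold muaB
  split_ifs
  exacts [muaV_nonneg n m i k, le_rfl]

theorem muaB_zero {n m : ℕ} (hm : m ≠ 0) (i : Fin n) : muaB n m i 0 = 0 := by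
  simp [muaB, muaV_zero hm]

theorem muaB_eq_zero_of_ne {n m : ℕ} (i : Fin n) {k : ℕ} (hk : k ≠ m) :
    muaB n m i k = 0 := by
  simp +contextual [muaB, muaV, hk]

theorem muaB_eq_two {n m : ℕ} {i : Fin n} (hi : m ≤ i) : muaB n m i m = 2 := by
  simp [muaB, muaV, hi.not_gt]

/-- In a feasible allocation of `m` units, two bidders get at most `m` units together. -/
theorem add_le_of_sum_le {n m : ℕ} {x : Fin n → ℕ} (hx : ∑ i, x i ≤ m) {i j : Fin n}
    (hij : i ≠ j) : x i + x j ≤ m := by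
  rw [← Finset.sum_pair hij]
  exact (Finset.sum_le_sum_of_subset (Finset.subset_univ _)).trans hx

/-- A welfare maximizer achieves declared welfare at least `c j m` for every bidder `j`. -/
theorem le_sum_of_forall_sum_le {n m : ℕ} {c : Fin n → ℕ → ℝ} {W : ℝ}
    (hc : ∀ i, c i 0 = 0)
    (h : ∀ x : Fin n → ℕ, ∑ i, x i ≤ m → ∑ i, c i (x i) ≤ W) (j : Fin n) :
    c j m ≤ W := by
  have hx := h (Pi.single j m) (by simp)
  rwa [Finset.sum_eq_single j (fun i _ hi => by simp [hi, hc]) (by simp),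
    Pi.single_eq_same] at hx

/-- **Proposition 1 of the paper.** In the multi-unit auction with
`n ≥ 4` bidders and `m = n − 2` units, for every exact declared-welfare maximizer `f`:
(i) the bid profile `muaB` is a pure Nash equilibrium of the pay-your-bid mechanism
under the valuations `muaV`, (ii) its welfare is `2`, while (iii) the optimal welfare
is `m`. -/
theorem multiunit_integral_poa
    (n : ℕ) (hn : 4 ≤ n)
    (f : (Fin n → ℕ → ℝ) → (Fin n → ℕ))
    (hffeas : ∀ b : Fin n → ℕ → ℝ, (∀ i, b i 0 = 0 ∧ ∀ k, 0 ≤ b i k) →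
      ∑ i, f b i ≤ n - 2)
    (hfopt : ∀ b : Fin n → ℕ → ℝ, (∀ i, b i 0 = 0 ∧ ∀ k, 0 ≤ b i k) →
      ∀ x : Fin n → ℕ, ∑ i, x i ≤ n - 2 → ∑ i, b i (f b i) ≥ ∑ i, b i (x i)) :
    (∀ (i : Fin n) (b' : ℕ → ℝ), b' 0 = 0 → (∀ k, 0 ≤ b' k) →
      muaV n (n - 2) i (f (muaB n (n - 2)) i) - muaB n (n - 2) i (f (muaB n (n - 2)) i)
        ≥ muaV n (n - 2) i (f (Function.update (muaB n (n - 2)) i b') i)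
          - b' (f (Function.update (muaB n (n - 2)) i b') i)) ∧
    (∑ i, muaV n (n - 2) i (f (muaB n (n - 2)) i) = 2) ∧
    (∀ x : Fin n → ℕ, ∑ i, x i ≤ n - 2 →
      ∑ i, muaV n (n - 2) i (x i) ≤ ((n : ℝ) - 2)) ∧
    (∃ x : Fin n → ℕ, ∑ i, x i ≤ n - 2 ∧
      ∑ i, muaV n (n - 2) i (x i) = ((n : ℝ) - 2)) := by
  obtain ⟨m, rfl⟩ : ∃ m, n = m + 2 := ⟨n - 2, by omega⟩
  simp only [Nat.add_sub_cancel] at hffeas hfopt ⊢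
  have hm2 : 2 ≤ m := by omega
  have hm0 : m ≠ 0 := by omega
  refine ⟨fun i b' hb0 hbnn => ?_, ?_, fun x hx => ?_, ?_⟩
  · have hcur := muaB_le_muaV (m + 2) m i (f (muaB (m + 2) m) i)
    set c := Function.update (muaB (m + 2) m) i b' with hc
    have hci : c i = b' := Function.update_self ..
    have hcne : ∀ l, l ≠ i → c l = muaB (m + 2) m l := fun l hl =>
      Function.update_of_ne hl ..
    have hvalid : ∀ l, c l 0 = 0 ∧ ∀ k, 0 ≤ c l k := fun l => by
      by_cases hl : l = i
      · subst hl; rw [hci]; exact ⟨hb0, hbnn⟩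
      · rw [hcne l hl]; exact ⟨muaB_zero hm0 l, muaB_nonneg _ _ l⟩
    have hdev : muaV (m + 2) m i (f c i) ≤ b' (f c i) := by
      by_cases hk : f c i = 0
      · rw [hk, hb0, muaV_zero hm0]
      obtain ⟨j, hji, hjm⟩ : ∃ j : Fin (m + 2), j ≠ i ∧ m ≤ j := by
        by_cases hi : (i : ℕ) = m
        · exact ⟨⟨m + 1, by omega⟩, by simp [Fin.ext_iff, hi], by simp⟩
        · exact ⟨⟨m, by omega⟩, by simpa [Fin.ext_iff] using Ne.symm hi, by simp⟩
      have htwo := le_sum_of_forall_sum_le (fun l => (hvalid l).1) (hfopt c hvalid) j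
      rw [hcne j hji, muaB_eq_two hjm, Finset.sum_eq_single i _ (by simp), hci] at htwo
      · exact (muaV_le_two _ _ _ _).trans htwo
      · intro l _ hl
        have := add_le_of_sum_le (hffeas c hvalid) hl
        rw [hcne l hl]
        exact muaB_eq_zero_of_ne l (by omega)
    linarith
  · have hvalid : ∀ l, muaB (m + 2) m l 0 = 0 ∧ ∀ k, 0 ≤ muaB (m + 2) m l k := fun l =>
      ⟨muaB_zero hm0 l, muaB_nonneg _ _ l⟩
    have htwo := le_sum_of_forall_sum_le (fun l => (hvalid l).1) (hfopt _ hvalid)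
      (Fin.last (m + 1))
    rw [muaB_eq_two (by simp)] at htwo
    obtain ⟨j, -, hj⟩ := Finset.exists_ne_zero_of_sum_ne_zero (by linarith : _ ≠ (0 : ℝ))
    have hfj : f (muaB (m + 2) m) j = m := by
      by_contra h
      exact hj (muaB_eq_zero_of_ne j h)
    have hjm : ¬ (j : ℕ) < m := fun h => hj (by simp [muaB, h])
    rw [Finset.sum_eq_single j _ (by simp), hfj]
    · simp [muaV, hjm]
    · intro l _ hl
      have := add_le_of_sum_le (hffeas _ hvalid) hl
      rw [show f (muaB (m + 2) m) l = 0 by omega, muaV_zero hm0]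
  · calc ∑ i, muaV (m + 2) m i (x i) ≤ ∑ i, (x i : ℝ) :=
          Finset.sum_le_sum fun i _ => muaV_le_cast hm2 i (x i)
      _ ≤ m := by exact_mod_cast hx
      _ = ((m + 2 : ℕ) : ℝ) - 2 := by push_cast; ring
  · refine ⟨fun i => if (i : ℕ) < m then 1 else 0, ?_, ?_⟩
    · rw [Fin.sum_univ_castSucc, Fin.sum_univ_castSucc]
      simp
    · rw [Fin.sum_univ_castSucc, Fin.sum_univ_castSucc]
      simp [muaV, hm0.symm]
end

section
/- Consider the single source unsplittable flow instance consisting of a single edge of capacity 1 and m+2 players, where m ≥ 2: players 1 and 2 have demand d_i = 1 and valuation v_i = 2, and players 3,…,m+2 have demand d_i = 1/m and valuation v_i = 1. Define bids b by b_1 = b_2 = 2 and b_i = 0 for all small players i. Then for every exact declared-welfare maximizer f: (i) b is a pure Nash equilibrium of the pay-your-bid mechanism under v, (ii) ∑_{i ∈ f(b)} v_i = 2, and (iii) max over feasible S of ∑_{i∈S} v_i = m. Hence the Price of Anarchy of this mechanism is at least m/2. -/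
open Finset

/-- Demands in the single-edge unsplittable-flow instance: the two big players have
demand `1`, the `m` small players have demand `1/m`. -/
noncomputable def sfD (m : ℕ) : Fin (m + 2) → ℝ := fun i => if (i : ℕ) < 2 then 1 else 1 / m

/-- Valuations: the two big players have value `2`, the `m` small players have value `1`. -/
noncomputable def sfV (m : ℕ) : Fin (m + 2) → ℝ := fun i => if (i : ℕ) < 2 then 2 else 1

/-- Equilibrium bids: the two big players bid `2`, the small players bid `0`. -/
noncomputable def sfB (m : ℕ) : Fin (m + 2) → ℝ := fun i => if (i : ℕ) < 2 then 2 else 0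

theorem sfD_pos {m : ℕ} (hm : 2 ≤ m) (i : Fin (m + 2)) : 0 < sfD m i := by
  have : (0 : ℝ) < m := by exact_mod_cast (by omega : 0 < m)
  unfold sfD
  split_ifs <;> positivity

theorem sfB_nonneg (m : ℕ) (i : Fin (m + 2)) : 0 ≤ sfB m i := by
  unfold sfB
  split_ifs <;> norm_num

/-- A feasible set containing a big player contains nobody else. -/
theorem eq_singleton_of_sum_sfD_le_one {m : ℕ} (hm : 2 ≤ m) {S : Finset (Fin (m + 2))}
    (hS : ∑ i ∈ S, sfD m i ≤ 1) {j : Fin (m + 2)} (hj : j ∈ S) (hj2 : (j : ℕ) < 2) :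
    S = {j} := by
  refine Finset.eq_singleton_iff_unique_mem.2 ⟨hj, fun k hk => ?_⟩
  by_contra hkj
  have hpair : ∑ i ∈ {k, j}, sfD m i ≤ ∑ i ∈ S, sfD m i :=
    Finset.sum_le_sum_of_subset_of_nonneg (by grind) fun i _ _ => (sfD_pos hm i).le
  rw [Finset.sum_pair hkj] at hpair
  have hDj : sfD m j = 1 := by simp [sfD, hj2]
  linarith [sfD_pos hm k]

/-- If a big player bids `2`, the chosen set collects at least `2`. -/
theorem two_le_of_big_bid {m : ℕ} {S : Finset (Fin (m + 2))} {b : Fin (m + 2) → ℝ}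
    (hopt : ∀ T : Finset (Fin (m + 2)), ∑ i ∈ T, sfD m i ≤ 1 → ∑ i ∈ S, b i ≥ ∑ i ∈ T, b i)
    {j : Fin (m + 2)} (hj : (j : ℕ) < 2) (hb : b j = 2) : 2 ≤ ∑ i ∈ S, b i := by
  simpa [hb] using hopt {j} (by rw [Finset.sum_singleton, sfD, if_pos hj])

theorem exists_big_ne {m : ℕ} (i : Fin (m + 2)) : ∃ j : Fin (m + 2), (j : ℕ) < 2 ∧ j ≠ i := by
  by_cases h : (i : ℕ) = 0
  · exact ⟨⟨1, by omega⟩, by simp, by simp [Fin.ext_iff, h]⟩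
  · exact ⟨⟨0, by omega⟩, by simp, by simp only [ne_eq, Fin.ext_iff]; omega⟩

/-- On a single unit-capacity edge with two big players (demand `1`,
value `2`) and `m ≥ 2` small players (demand `1/m`, value `1`), for every exact
declared-welfare maximizer `f`: (i) the bids `sfB` form a pure Nash equilibrium of the
pay-your-bid mechanism under the valuations `sfV`, (ii) its welfare is `2`, and (iii) the
optimal welfare is `m`; hence the Price of Anarchy is at least `m/2`. -/
theorem single_source_flow_integral_poa
    (m : ℕ) (hm : 2 ≤ m)
    (f : (Fin (m + 2) → ℝ) → Finset (Fin (m + 2)))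
    (hffeas : ∀ b : Fin (m + 2) → ℝ, (∀ i, 0 ≤ b i) → ∑ i ∈ f b, sfD m i ≤ 1)
    (hfopt : ∀ b : Fin (m + 2) → ℝ, (∀ i, 0 ≤ b i) → ∀ S : Finset (Fin (m + 2)),
      (∑ i ∈ S, sfD m i ≤ 1) → ∑ i ∈ f b, b i ≥ ∑ i ∈ S, b i) :
    (∀ (i : Fin (m + 2)) (r : ℝ), 0 ≤ r →
      (if i ∈ f (sfB m) then sfV m i - sfB m i else 0)
        ≥ (if i ∈ f (Function.update (sfB m) i r) then sfV m i - r else 0)) ∧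
    (∑ i ∈ f (sfB m), sfV m i = 2) ∧
    (∀ S : Finset (Fin (m + 2)), ∑ i ∈ S, sfD m i ≤ 1 → ∑ i ∈ S, sfV m i ≤ (m : ℝ)) ∧
    (∃ S : Finset (Fin (m + 2)), ∑ i ∈ S, sfD m i ≤ 1 ∧ ∑ i ∈ S, sfV m i = (m : ℝ)) := by
  have hm0 : (0 : ℝ) < m := by exact_mod_cast (by omega : 0 < m)
  refine ⟨fun i r hr => ?_, ?_, fun S hS => ?_, ?_⟩
  · have hlhs : 0 ≤ if i ∈ f (sfB m) then sfV m i - sfB m i else 0 := by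
      unfold sfV sfB
      split_ifs <;> norm_num
    refine ge_iff_le.2 (le_trans ?_ hlhs)
    split_ifs with hi
    swap
    · exact le_rfl
    by_contra! hpos
    set b := Function.update (sfB m) i r with hb
    have hb0 : ∀ k, 0 ≤ b k := by
      intro k
      by_cases hk : k = i
      · simpa [hb, hk] using hr
      · simpa [hb, hk] using sfB_nonneg m k
    obtain ⟨j, hj, hji⟩ := exists_big_ne i
    have htwo : 2 ≤ ∑ k ∈ f b, b k :=
      two_le_of_big_bid (hfopt b hb0) hj (by simp [hb, hji, sfB, hj])
    have hsum : ∑ k ∈ f b, b k = b i := by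
      refine Finset.sum_eq_single_of_mem i hi fun k hk hki => ?_
      by_cases hk2 : (k : ℕ) < 2
      · rw [eq_singleton_of_sum_sfD_le_one hm (hffeas b hb0) hk hk2] at hi
        exact absurd (Finset.mem_singleton.1 hi).symm hki
      · simp [hb, hki, sfB, hk2]
    have hbi : b i = r := by simp [hb]
    have hv : sfV m i ≤ 2 := by
      unfold sfV
      split_ifs <;> norm_num
    linarith
  · have htwo : 2 ≤ ∑ k ∈ f (sfB m), sfB m k :=
      two_le_of_big_bid (hfopt _ (sfB_nonneg m)) (j := ⟨0, by omega⟩) (by simp) (by simp [sfB])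
    obtain ⟨j, hj, hj0⟩ := Finset.exists_ne_zero_of_sum_ne_zero (by linarith : _ ≠ (0 : ℝ))
    have hj2 : (j : ℕ) < 2 := by
      by_contra h
      exact hj0 (by simp [sfB, h])
    rw [eq_singleton_of_sum_sfD_le_one hm (hffeas _ (sfB_nonneg m)) hj hj2]
    rw [Finset.sum_singleton, sfV, if_pos hj2]
  · by_cases h : ∃ j ∈ S, (j : ℕ) < 2
    · obtain ⟨j, hj, hj2⟩ := h
      rw [eq_singleton_of_sum_sfD_le_one hm hS hj hj2]
      rw [Finset.sum_singleton, sfV, if_pos hj2]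
      exact_mod_cast hm
    · push Not at h
      have hVD : ∑ i ∈ S, sfV m i = m * ∑ i ∈ S, sfD m i := by
        rw [Finset.mul_sum]
        refine Finset.sum_congr rfl fun i hi => ?_
        simp [sfV, sfD, (h i hi).not_gt, hm0.ne']
      rw [hVD]
      nlinarith
  · refine ⟨Finset.univ.map (Fin.natAddEmb 2 |>.trans (finCongr (Nat.add_comm 2 m)).toEmbedding),
      ?_, ?_⟩
    · simp [sfD, hm0.ne']
    · simp [sfV]
end

section
/- Let V be a finite set with at least 2 elements, let σ be a derangement of V, and let u, v ∈ V with u ≠ v. Then there exists a derangement σ' of V with σ'(u) = v such that σ' differs from σ in at most 3 points, i.e. the set {x ∈ V : σ'(x) ≠ σ(x)} has cardinality at most 3. -/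
open Finset

/-- Any prescribed edge `(u, v)` can be incorporated into a given
cycle cover (derangement) of a finite set `V` with `|V| ≥ 2` while changing the
successors of at most `3` vertices. -/
theorem derangement_edge_insertion
    {V : Type*} [Fintype V] [DecidableEq V] (hV : 2 ≤ Fintype.card V)
    (σ : Equiv.Perm V) (hσ : ∀ x, σ x ≠ x) (u v : V) (huv : u ≠ v) :
    ∃ σ' : Equiv.Perm V, (∀ x, σ' x ≠ x) ∧ σ' u = v ∧
      (univ.filter fun x => σ' x ≠ σ x).card ≤ 3 := by
  obtain ⟨w, hw⟩ := σ.surjective v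
  have hwv : w ≠ v := fun h => hσ w (hw.trans h.symm)
  suffices h : ∃ σ' : Equiv.Perm V, (∀ x, σ' x ≠ x) ∧ σ' u = v ∧
      ∀ x, σ' x ≠ σ x → x = u ∨ x = v ∨ x = w by
    obtain ⟨σ', hfix, huv', hdiff⟩ := h
    refine ⟨σ', hfix, huv', (card_le_card fun x hx => ?_).trans
      (card_le_three (a := u) (b := v) (c := w))⟩
    simpa using hdiff x (by simpa using hx)
  by_cases huw : σ u = w
  · have huw' : u ≠ w := fun h => hσ u (huw.trans h.symm)
    have hvw : σ v ≠ w := fun h => huv (σ.injective (huw.trans h.symm))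
    refine ⟨σ * Equiv.swap u w * Equiv.swap v w, fun x => ?_, ?_, fun x => ?_⟩ <;>
      simp only [Equiv.Perm.mul_apply, Equiv.swap_apply_def] <;> grind
  · refine ⟨σ * Equiv.swap u w, fun x => ?_, ?_, fun x => ?_⟩ <;>
      simp only [Equiv.Perm.mul_apply, Equiv.swap_apply_def] <;> grind
end

section
/- Let V be a finite set with |V| ≥ 2 and let b be a nonnegative weight function on ordered pairs of distinct elements of V. Then for every derangement τ of V, ∑_{u∈V} ( W^{b_{-(u,τ(u))}} − W^{b_{-(u,τ(u))}}_{(u,τ(u))} ) ≤ 3·W^{b}. -/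
open Finset

/-- `derW b` is the maximum weight `W^b` of a cycle cover (derangement) of `V`
under the weight function `b`. -/
noncomputable def derW {V : Type*} [Fintype V] (b : V → V → ℝ) : ℝ :=
  sSup {w : ℝ | ∃ σ : Equiv.Perm V, (∀ x, σ x ≠ x) ∧ w = ∑ x, b x (σ x)}

/-- `derWedge b u v` is the maximum weight `W^b_{(u,v)}` of a cycle cover (derangement)
of `V` that uses the edge `(u, v)`, under the weight function `b`. -/
noncomputable def derWedge {V : Type*} [Fintype V] (b : V → V → ℝ) (u v : V) : ℝ :=
  sSup {w : ℝ | ∃ σ : Equiv.Perm V, (∀ x, σ x ≠ x) ∧ σ u = v ∧ w = ∑ x, b x (σ x)}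

/-- Any derangement can be rerouted through a given edge `(u, v)` by changing it only at
`u`, `v` and the predecessor of `v`. -/
theorem exists_derangement_through_edge {V : Type*} [DecidableEq V] (σ : Equiv.Perm V)
    (hσ : ∀ x, σ x ≠ x) {u v : V} (huv : v ≠ u) :
    ∃ ρ : Equiv.Perm V, (∀ x, ρ x ≠ x) ∧ ρ u = v ∧
      ∀ x, x ≠ u → x ≠ σ.symm v → x ≠ v → ρ x = σ x := by
  by_cases h : σ (σ u) = v
  · have hv : σ v ≠ σ u := fun e => huv (σ.injective e)
    refine ⟨Equiv.swap (σ u) (σ v) * Equiv.swap (σ u) v * σ, fun x => ?_, ?_, ?_⟩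
    · have h1 := hσ x
      have h2 := hσ v
      have h3 := hσ u
      have h4 : σ x = σ u → x = u := fun e => σ.injective e
      have h5 : σ x = v → x = σ u := fun e => σ.injective (e.trans h.symm)
      have h6 : σ x = σ v → x = v := fun e => σ.injective e
      simp only [Equiv.Perm.mul_apply, Equiv.swap_apply_def]
      grind
    · have h2 := hσ v
      have h3 := hσ (σ u)
      simp only [Equiv.Perm.mul_apply, Equiv.swap_apply_def]
      grind
    · intro x h1 h2 h3
      have h4 : σ x ≠ σ u := fun e => h1 (σ.injective e)
      have h5 : σ x ≠ v := fun e => h2 ((Equiv.eq_symm_apply σ).2 e)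
      have h6 : σ x ≠ σ v := fun e => h3 (σ.injective e)
      simp [Equiv.swap_apply_of_ne_of_ne, h4, h5, h6]
  · refine ⟨Equiv.swap (σ u) v * σ, fun x => ?_, by simp, ?_⟩
    · have h1 := hσ x
      have h4 : σ x = σ u → x = u := fun e => σ.injective e
      simp only [Equiv.Perm.mul_apply, Equiv.swap_apply_def]
      grind
    · intro x h1 h2 _
      have h4 : σ x ≠ σ u := fun e => h1 (σ.injective e)
      have h5 : σ x ≠ v := fun e => h2 ((Equiv.eq_symm_apply σ).2 e)
      simp [Equiv.swap_apply_of_ne_of_ne, h4, h5]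

theorem le_derW {V : Type*} [Fintype V] (b : V → V → ℝ) (σ : Equiv.Perm V)
    (hσ : ∀ x, σ x ≠ x) : ∑ x, b x (σ x) ≤ derW b := by
  classical
  refine le_csSup (Set.Finite.bddAbove ?_) ⟨σ, hσ, rfl⟩
  refine (Set.finite_range fun σ : Equiv.Perm V => ∑ x, b x (σ x)).subset ?_
  rintro _ ⟨ρ, _, rfl⟩
  exact ⟨ρ, rfl⟩

theorem le_derWedge {V : Type*} [Fintype V] (b : V → V → ℝ) {u v : V} (σ : Equiv.Perm V)
    (hσ : ∀ x, σ x ≠ x) (huv : σ u = v) : ∑ x, b x (σ x) ≤ derWedge b u v := by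
  classical
  refine le_csSup (Set.Finite.bddAbove ?_) ⟨σ, hσ, huv, rfl⟩
  refine (Set.finite_range fun σ : Equiv.Perm V => ∑ x, b x (σ x)).subset ?_
  rintro _ ⟨ρ, _, _, rfl⟩
  exact ⟨ρ, rfl⟩

theorem exists_derW_eq {V : Type*} [Fintype V] (b : V → V → ℝ)
    (h : ∃ σ : Equiv.Perm V, ∀ x, σ x ≠ x) :
    ∃ σ : Equiv.Perm V, (∀ x, σ x ≠ x) ∧ derW b = ∑ x, b x (σ x) := by
  classical
  obtain ⟨τ, hτ⟩ := h
  have hfin : {w : ℝ | ∃ σ : Equiv.Perm V, (∀ x, σ x ≠ x) ∧ w = ∑ x, b x (σ x)}.Finite := by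
    refine (Set.finite_range fun σ : Equiv.Perm V => ∑ x, b x (σ x)).subset ?_
    rintro _ ⟨ρ, _, rfl⟩
    exact ⟨ρ, rfl⟩
  have hne : {w : ℝ | ∃ σ : Equiv.Perm V, (∀ x, σ x ≠ x) ∧ w = ∑ x, b x (σ x)}.Nonempty :=
    ⟨_, τ, hτ, rfl⟩
  exact hne.csSup_mem hfin

theorem derW_mono {V : Type*} [Fintype V] {b c : V → V → ℝ}
    (h : ∃ σ : Equiv.Perm V, ∀ x, σ x ≠ x) (hbc : ∀ x y, x ≠ y → b x y ≤ c x y) :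
    derW b ≤ derW c := by
  obtain ⟨σ, hσ, hW⟩ := exists_derW_eq b h
  rw [hW]
  exact (sum_le_sum fun x _ => hbc x (σ x) (hσ x).symm).trans (le_derW c σ hσ)

/-- After erasing the weight of `(u, v)`, forcing that edge costs at most the weights that `σ`
puts on the edges leaving `u`, entering `v` and leaving `v`. -/
theorem sum_sub_le_derWedge {V : Type*} [Fintype V] [DecidableEq V] (b : V → V → ℝ)
    (hb : ∀ u w, u ≠ w → 0 ≤ b u w) (σ : Equiv.Perm V) (hσ : ∀ x, σ x ≠ x) {u v : V}
    (huv : v ≠ u) :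
    ∑ x, b x (σ x) - (b u (σ u) + b (σ.symm v) v + b v (σ v))
      ≤ derWedge (fun x y => if x = u ∧ y = v then 0 else b x y) u v := by
  obtain ⟨ρ, hρ, hρu, hagree⟩ := exists_derangement_through_edge σ hσ huv
  refine le_trans ?_ (le_derWedge _ ρ hρ hρu)
  have hnn : ∀ x, 0 ≤ b x (σ x) := fun x => hb _ _ (hσ x).symm
  have key : ∑ x, b x (σ x) ≤ ∑ x, ((if x = u ∧ ρ x = v then 0 else b x (ρ x))
      + ((if x = u then b x (σ x) else 0) + (if x = σ.symm v then b x (σ x) else 0)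
        + (if x = v then b x (σ x) else 0))) := by
    refine sum_le_sum fun x _ => ?_
    have h1 := hnn x
    have h2 := hb _ _ (hρ x).symm
    have h3 := hagree x
    grind
  simp only [sum_add_distrib, sum_ite_eq', mem_univ, if_true, Equiv.apply_symm_apply] at key
  linarith

/-- **Lemma 6 of the paper.** For any derangement `τ` of `V`,
`∑_{u} (W^{b₋(u,τ u)} − W^{b₋(u,τ u)}_{(u,τ u)}) ≤ 3·W^b`. -/
theorem cycle_cover_net_loss_bound
    {V : Type*} [Fintype V] [DecidableEq V] (hV : 2 ≤ Fintype.card V)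
    (b : V → V → ℝ) (hb : ∀ u w, u ≠ w → 0 ≤ b u w)
    (τ : Equiv.Perm V) (hτ : ∀ x, τ x ≠ x) :
    ∑ u, (derW (fun x y => if x = u ∧ y = τ u then 0 else b x y)
          - derWedge (fun x y => if x = u ∧ y = τ u then 0 else b x y) u (τ u))
      ≤ 3 * derW b := by
  obtain ⟨σ, hσ, hW⟩ := exists_derW_eq b ⟨τ, hτ⟩
  have hloss : ∀ u, derW (fun x y => if x = u ∧ y = τ u then 0 else b x y)
      - derWedge (fun x y => if x = u ∧ y = τ u then 0 else b x y) u (τ u)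
      ≤ b u (σ u) + b (σ.symm (τ u)) (τ u) + b (τ u) (σ (τ u)) := by
    intro u
    have h1 := sum_sub_le_derWedge b hb σ hσ (hτ u)
    have h2 : derW (fun x y => if x = u ∧ y = τ u then 0 else b x y) ≤ derW b := by
      refine derW_mono ⟨τ, hτ⟩ fun x y hxy => ?_
      have := hb x y hxy
      split_ifs <;> simp [this]
    linarith
  refine (sum_le_sum fun u _ => hloss u).trans (le_of_eq ?_)
  have h1 : ∑ u, b (τ u) (σ (τ u)) = ∑ x, b x (σ x) :=
    Equiv.sum_comp τ fun x => b x (σ x)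
  have h2 : ∑ u, b (σ.symm (τ u)) (τ u) = ∑ x, b x (σ x) := by
    rw [← Equiv.sum_comp (τ.trans σ.symm) fun x => b x (σ x)]
    simp
  rw [sum_add_distrib, sum_add_distrib, h1, h2, hW]
  ring
end

section
/- Let V be a finite set with |V| ≥ 2 and let σ be a derangement of V. Then there exists a finitely-supported probability distribution p on the set of tours of V such that for every x ∈ V, the probability that the tour agrees with σ at x is at least 1/2: ∑_{τ tour, τ(x)=σ(x)} p(τ) ≥ 1/2. Consequently, for every nonnegative weight function w on ordered pairs of distinct elements of V, E_{τ∼p}[∑_{x∈V} w(x,τ(x))] ≥ (1/2)·∑_{x∈V} w(x,σ(x)). -/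
open Finset

namespace Equiv.Perm

variable {V : Type*}

theorem SameCycle.of_forall_apply {σ τ : Equiv.Perm V} (h : ∀ x, τ.SameCycle x (σ x))
    {x y : V} (hxy : σ.SameCycle x y) : τ.SameCycle x y := by
  obtain ⟨n, rfl⟩ := hxy
  induction n using Int.induction_on with
  | zero => exact SameCycle.refl τ x
  | succ n ih =>
    rw [add_comm, zpow_add, zpow_one]
    exact ih.trans (h _)
  | pred n ih =>
    refine ih.trans ?_
    have h' := h ((σ ^ (-(n : ℤ) - 1)) x)
    rw [← mul_apply, mul_self_zpow, sub_add_cancel] at h'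
    exact h'.symm

theorem isCycle_and_support_eq_univ [Fintype V] [DecidableEq V] [Nontrivial V] {τ : Equiv.Perm V}
    (h : ∀ x y, τ.SameCycle x y) : τ.IsCycle ∧ τ.support = univ := by
  have hne : ∀ x, τ x ≠ x := fun x hx => by
    obtain ⟨y, hy⟩ := exists_ne x
    exact hy ((h x y).eq_of_left hx).symm
  obtain ⟨x⟩ : Nonempty V := inferInstance
  exact ⟨⟨x, hne x, fun y _ => h x y⟩, by ext y; simp [hne y]⟩

variable [Finite V] [DecidableEq V]

theorem sameCycle_mul_swap {σ : Equiv.Perm V} {r s : V} (hrs : ¬ σ.SameCycle r s) :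
    (σ * Equiv.swap r s).SameCycle r s := by
  have key : ∀ n : ℕ, (σ * Equiv.swap r s).SameCycle r ((σ ^ (n + 1)) s) ∨
      (σ * Equiv.swap r s).SameCycle r s := by
    intro n
    induction n with
    | zero => exact Or.inl ⟨1, by simp⟩
    | succ n ih =>
      refine ih.elim (fun h => ?_) Or.inr
      by_cases hs : (σ ^ (n + 1)) s = s
      · exact Or.inr (by rwa [hs] at h)
      · have hr : (σ ^ (n + 1)) s ≠ r := fun e =>
          hrs (SameCycle.symm ⟨((n + 1 : ℕ) : ℤ), by rw [zpow_natCast, e]⟩)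
        refine Or.inl (h.trans ⟨1, ?_⟩)
        rw [zpow_one, mul_apply, Equiv.swap_apply_of_ne_of_ne hr hs, pow_succ' σ (n + 1), mul_apply]
  obtain h | h := key (orderOf σ - 1)
  · rwa [Nat.sub_add_cancel (orderOf_pos σ), pow_orderOf_eq_one, one_apply] at h
  · exact h

theorem SameCycle.mul_swap {σ : Equiv.Perm V} {r s : V} (hrs : ¬ σ.SameCycle r s) {x y : V}
    (hxy : σ.SameCycle x y) : (σ * Equiv.swap r s).SameCycle x y := by
  have h := sameCycle_mul_swap hrs
  refine SameCycle.of_forall_apply (fun z => ?_) hxy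
  by_cases hzr : z = r
  · subst hzr
    exact h.trans ⟨1, by simp⟩
  by_cases hzs : z = s
  · subst hzs
    exact h.symm.trans ⟨1, by simp⟩
  exact ⟨1, by simp [Equiv.swap_apply_of_ne_of_ne hzr hzs]⟩

/-- If `R` meets every cycle of `σ`, then the values of `σ` on `R` can be changed so that
all cycles are merged into one. -/
theorem exists_forall_sameCycle_of_transversal {R : Finset V} (hR : R.Nonempty)
    (σ : Equiv.Perm V) (h : ∀ x, ∃ r ∈ R, σ.SameCycle r x) :
    ∃ τ : Equiv.Perm V, (∀ x ∉ R, τ x = σ x) ∧ ∀ x y, τ.SameCycle x y := by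
  induction hR using Finset.Nonempty.cons_induction generalizing σ with
  | singleton a =>
    simp only [mem_singleton, exists_eq_left] at h
    exact ⟨σ, fun _ _ => rfl, fun x y => (h x).symm.trans (h y)⟩
  | cons a t ha ht ih =>
    obtain ⟨r, hr⟩ := ht
    by_cases hra : σ.SameCycle r a
    · obtain ⟨τ, hτ, hτ'⟩ := ih σ fun x => by
        obtain ⟨q, hq, hqx⟩ := h x
        obtain rfl | hq := mem_cons.mp hq
        · exact ⟨r, hr, hra.trans hqx⟩
        · exact ⟨q, hq, hqx⟩
      exact ⟨τ, fun x hx => hτ x fun hxt => hx (mem_cons.mpr (Or.inr hxt)), hτ'⟩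
    · obtain ⟨τ, hτ, hτ'⟩ := ih (σ * Equiv.swap r a) fun x => by
        obtain ⟨q, hq, hqx⟩ := h x
        obtain rfl | hq := mem_cons.mp hq
        · exact ⟨r, hr, (sameCycle_mul_swap hra).trans (hqx.mul_swap hra)⟩
        · exact ⟨q, hq, hqx.mul_swap hra⟩
      refine ⟨τ, fun x hx => ?_, hτ'⟩
      rw [mem_cons, not_or] at hx
      rw [hτ x hx.2, mul_apply,
        Equiv.swap_apply_of_ne_of_ne (ne_of_mem_of_not_mem hr hx.2).symm hx.1]

/-- The edges of a derangement are covered by two permutations that are each a single cycle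
on the whole type. -/
theorem exists_two_sameCycle_cover [Nonempty V] (σ : Equiv.Perm V) (hσ : ∀ x, σ x ≠ x) :
    ∃ τ₁ τ₂ : Equiv.Perm V, (∀ x y, τ₁.SameCycle x y) ∧ (∀ x y, τ₂.SameCycle x y) ∧
      ∀ x, τ₁ x = σ x ∨ τ₂ x = σ x := by
  have := Fintype.ofFinite V
  let rep : V → V := fun x => (Quotient.mk (SameCycle.setoid σ) x).out
  have rep_same : ∀ x, σ.SameCycle (rep x) x := fun x => Quotient.mk_out (s := SameCycle.setoid σ) x
  have rep_congr : ∀ {x y}, σ.SameCycle x y → rep x = rep y := fun {x y} hxy =>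
    congrArg Quotient.out (Quotient.sound (s := SameCycle.setoid σ) hxy)
  let R : Finset V := univ.image rep
  have hR : R.Nonempty := univ_nonempty.image rep
  have hmem : ∀ x, rep x ∈ R := fun x => mem_image_of_mem rep (mem_univ x)
  obtain ⟨τ₁, h₁, h₁'⟩ := exists_forall_sameCycle_of_transversal hR σ
    fun x => ⟨rep x, hmem x, rep_same x⟩
  obtain ⟨τ₂, h₂, h₂'⟩ := exists_forall_sameCycle_of_transversal (hR.image σ) σ
    fun x => ⟨σ (rep x), mem_image_of_mem σ (hmem x), sameCycle_apply_left.mpr (rep_same x)⟩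
  refine ⟨τ₁, τ₂, h₁', h₂', fun x => ?_⟩
  by_cases hx : x ∈ R
  · refine Or.inr (h₂ x fun hx' => ?_)
    obtain ⟨y, hy, rfl⟩ := mem_image.mp hx'
    obtain ⟨u, -, rfl⟩ := mem_image.mp hy
    obtain ⟨v, -, hv⟩ := mem_image.mp hx
    refine hσ (rep u) ?_
    rw [← hv]
    refine rep_congr ((rep_same v).symm.trans ?_)
    rw [hv]
    exact sameCycle_apply_left.mpr (rep_same u)
  · exact Or.inl (h₁ x hx)

end Equiv.Perm

/-- The randomized version of Fisher's algorithm is a `2`-approximate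
oblivious rounding scheme from cycle covers to tours: for every derangement `σ` of a
finite set `V` with `|V| ≥ 2` there is a finitely-supported probability distribution `p`
on tours (single cycles on all of `V`) such that each edge of `σ` survives with
probability at least `1/2`; consequently, for every nonnegative weight function `w`,
the expected weight of the tour is at least half the weight of `σ`. -/
theorem cycle_cover_oblivious_rounding_to_tours
    {V : Type*} [Fintype V] [DecidableEq V] (hV : 2 ≤ Fintype.card V)
    (σ : Equiv.Perm V) (hσ : ∀ x, σ x ≠ x) :
    ∃ p : Equiv.Perm V → ℝ, (∀ τ, 0 ≤ p τ) ∧ (∑ τ, p τ = 1) ∧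
      (∀ τ : Equiv.Perm V, p τ ≠ 0 → τ.IsCycle ∧ τ.support = univ) ∧
      (∀ x : V, ∑ τ ∈ univ.filter (fun τ : Equiv.Perm V => τ x = σ x), p τ ≥ 1 / 2) ∧
      (∀ w : V → V → ℝ, (∀ u y, u ≠ y → 0 ≤ w u y) →
        ∑ τ : Equiv.Perm V, p τ * ∑ x, w x (τ x) ≥ 1 / 2 * ∑ x, w x (σ x)) := by
  have : Nontrivial V := Fintype.one_lt_card_iff_nontrivial.mp hV
  obtain ⟨τ₁, τ₂, h₁, h₂, hcover⟩ := Equiv.Perm.exists_two_sameCycle_cover σ hσ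
  let p : Equiv.Perm V → ℝ := fun τ =>
    (if τ = τ₁ then 1 / 2 else 0) + (if τ = τ₂ then 1 / 2 else 0)
  have hp : ∀ f : Equiv.Perm V → ℝ, ∑ τ, p τ * f τ = 1 / 2 * f τ₁ + 1 / 2 * f τ₂ := fun f => by
    simp [p, add_mul, sum_add_distrib, ite_mul]
  refine ⟨p, fun τ => by positivity, ?_, fun τ hτ => ?_, fun x => ?_, fun w hw => ?_⟩
  · have h := hp fun _ => 1
    simp only [mul_one] at h
    rw [h]
    norm_num
  · apply Equiv.Perm.isCycle_and_support_eq_univ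
    by_cases e₁ : τ = τ₁
    · exact e₁ ▸ h₁
    by_cases e₂ : τ = τ₂
    · exact e₂ ▸ h₂
    exact absurd (by simp [p, e₁, e₂]) hτ
  · have h := hp fun τ => if τ x = σ x then 1 else 0
    simp only [mul_ite, mul_one, mul_zero] at h
    rw [sum_filter, h]
    obtain hx | hx := hcover x <;> rw [if_pos hx] <;> split_ifs <;> norm_num
  · have hne : ∀ {τ : Equiv.Perm V}, (∀ x y, τ.SameCycle x y) → ∀ x, x ≠ τ x := fun {τ} h x =>
      (Equiv.Perm.mem_support.mp
        ((Equiv.Perm.isCycle_and_support_eq_univ h).2 ▸ mem_univ x)).symm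
    rw [hp, ← mul_add, ← sum_add_distrib]
    refine mul_le_mul_of_nonneg_left (sum_le_sum fun x _ => ?_) (by norm_num)
    have hw₁ := hw _ _ (hne h₁ x)
    have hw₂ := hw _ _ (hne h₂ x)
    obtain hx | hx := hcover x <;> rw [hx] at * <;> linarith
end

section
/- Let b=(b_i)_{i∈N} be a profile of MPH-k bids and let x be a fractional allocation feasible for the all-ones capacity vector 1. Then ∑_{i∈N} ( W^{b_{-i}}(1) − W^{b_{-i}}(1 − x_i) ) ≤ (k+1)·W^{b}(1), where 1 − x_i is the capacity vector whose entry for item j is 1 − ∑_{S : j∈S} x_{i,S}. -/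
open Finset

/-- A function `v` on bundles of the `m` items is MPH-`k` (maximum over positive
hypergraphs of rank `k`) if it is the maximum, over a nonempty finite index set, of sums
of nonnegative weights on nonempty bundles of at most `k` items. -/
def IsMPH (m k : ℕ) (v : Finset (Fin m) → ℝ) : Prop :=
  ∃ (n : ℕ) (w : Fin (n + 1) → Finset (Fin m) → ℝ),
    (∀ ℓ T, 0 ≤ w ℓ T) ∧
    ∀ S : Finset (Fin m), v S = univ.sup' univ_nonempty
      (fun ℓ => ∑ T ∈ S.powerset.filter (fun T => 1 ≤ T.card ∧ T.card ≤ k), w ℓ T)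

/-- A fractional allocation of the configuration LP, feasible for item capacities `q`. -/
def CAFeasible {N : Type*} [Fintype N] (m : ℕ) (q : Fin m → ℝ)
    (x : N → Finset (Fin m) → ℝ) : Prop :=
  (∀ i S, 0 ≤ x i S) ∧ (∀ i, ∑ S, x i S ≤ 1) ∧
    ∀ j : Fin m, ∑ i, ∑ S ∈ univ.filter (fun S : Finset (Fin m) => j ∈ S), x i S ≤ q j

/-- `caW m b q` is the optimal declared welfare `W^b(q)` of the configuration LP. -/
noncomputable def caW {N : Type*} [Fintype N] (m : ℕ) (b : N → Finset (Fin m) → ℝ)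
    (q : Fin m → ℝ) : ℝ :=
  sSup {w : ℝ | ∃ x : N → Finset (Fin m) → ℝ, CAFeasible m q x ∧
    w = ∑ i, ∑ S, b i S * x i S}

/-- Independent removal of items: a distribution on sets of items with prescribed marginals. -/
theorem exists_weight_with_marginals {m : ℕ} (z : Fin m → ℝ) (h0 : ∀ j, 0 ≤ z j)
    (h1 : ∀ j, z j ≤ 1) :
    ∃ p : Finset (Fin m) → ℝ, (∀ R, 0 ≤ p R) ∧ ∑ R, p R = 1 ∧
      ∀ j, ∑ R, (if j ∈ R then p R else 0) = z j := by
  refine ⟨fun R => (∏ a ∈ R, z a) * ∏ a ∈ univ \ R, (1 - z a), fun R => ?_, ?_, fun j => ?_⟩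
  · exact mul_nonneg (prod_nonneg fun a _ => h0 a)
      (prod_nonneg fun a _ => sub_nonneg.2 (h1 a))
  · rw [← powerset_univ, ← prod_add]
    simp
  · have key := prod_add z (fun a => if a = j then 0 else 1 - z a) univ
    have hprod : ∏ a, (z a + if a = j then 0 else 1 - z a) = z j := by
      rw [prod_eq_single j]
      · simp
      · exact fun a _ ha => by simp [ha]
      · simp
    rw [hprod, powerset_univ] at key
    rw [key]
    refine sum_congr rfl fun R _ => ?_
    split_ifs with hj
    · refine congrArg (_ * ·) (prod_congr rfl fun a ha => ?_)
      rw [if_neg]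
      rintro rfl
      exact (mem_sdiff.1 ha).2 hj
    · have h_zero : ∏ a ∈ univ \ R, (if a = j then 0 else 1 - z a) = 0 :=
        prod_eq_zero (mem_sdiff.2 ⟨mem_univ j, hj⟩) (by simp)
      rw [h_zero, mul_zero]

theorem IsMPH.nonneg {m k : ℕ} {v : Finset (Fin m) → ℝ} (hv : IsMPH m k v)
    (S : Finset (Fin m)) : 0 ≤ v S := by
  obtain ⟨n, w, hw, hv⟩ := hv
  rw [hv]
  exact (sum_nonneg fun T _ => hw 0 T).trans
    (le_sup' (fun ℓ => ∑ T ∈ S.powerset.filter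
      (fun T : Finset (Fin m) => 1 ≤ T.card ∧ T.card ≤ k), w ℓ T)
      (mem_univ 0))

/-- An MPH-`k` valuation has, at every bundle, item prices that bound the loss caused by
removing items and whose total is at most `k` times the value of the bundle. -/
theorem IsMPH.exists_prices {m k : ℕ} {v : Finset (Fin m) → ℝ} (hv : IsMPH m k v)
    (S : Finset (Fin m)) :
    ∃ a : Fin m → ℝ, (∀ j, 0 ≤ a j) ∧ ∑ j, a j ≤ k * v S ∧
      ∀ R, v S - ∑ j ∈ R, a j ≤ v (S \ R) := by
  obtain ⟨n, w, hw, hv⟩ := hv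
  obtain ⟨ℓ, -, hℓ⟩ := exists_mem_eq_sup' (univ_nonempty (α := Fin (n + 1)))
    (fun ℓ => ∑ T ∈ S.powerset.filter (fun T : Finset (Fin m) => 1 ≤ T.card ∧ T.card ≤ k), w ℓ T)
  rw [← hv] at hℓ
  set F := S.powerset.filter (fun T => 1 ≤ T.card ∧ T.card ≤ k) with hF
  refine ⟨fun j => ∑ T ∈ F, if j ∈ T then w ℓ T else 0, fun j => ?_, ?_, fun R => ?_⟩
  · refine sum_nonneg fun T _ => ?_
    split_ifs
    exacts [hw ℓ T, le_rfl]
  · rw [sum_comm, hℓ, mul_sum]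
    refine sum_le_sum fun T hT => ?_
    rw [sum_ite_mem, univ_inter, sum_const, nsmul_eq_mul]
    exact mul_le_mul_of_nonneg_right (by exact_mod_cast (mem_filter.1 hT).2.2) (hw ℓ T)
  · have hle : ∑ T ∈ (S \ R).powerset.filter (fun T => 1 ≤ T.card ∧ T.card ≤ k), w ℓ T
        ≤ v (S \ R) := by
      rw [hv]
      exact le_sup' (fun ℓ => ∑ T ∈ (S \ R).powerset.filter
        (fun T : Finset (Fin m) => 1 ≤ T.card ∧ T.card ≤ k), w ℓ T) (mem_univ ℓ)
    refine le_trans ?_ hle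
    have hset : (S \ R).powerset.filter (fun T => 1 ≤ T.card ∧ T.card ≤ k)
        = F.filter (fun T => Disjoint T R) := by
      ext T
      simp only [hF, mem_filter, mem_powerset, subset_sdiff]
      tauto
    rw [hset, sum_filter, hℓ, sum_comm, ← sum_sub_distrib]
    refine sum_le_sum fun T _ => ?_
    have hnn : ∀ j ∈ R, 0 ≤ if j ∈ T then w ℓ T else 0 := fun j _ => by
      split_ifs
      exacts [hw ℓ T, le_rfl]
    split_ifs with hd
    · linarith [sum_nonneg hnn]
    · obtain ⟨j, hjT, hjR⟩ := not_disjoint_iff.1 hd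
      have := single_le_sum hnn hjR
      rw [if_pos hjT] at this
      linarith

/-- Removing items with marginal probabilities `z` costs an MPH-`k` valuation at most the
price of the removed capacities. -/
theorem IsMPH.exists_prices_average {m k : ℕ} {v : Finset (Fin m) → ℝ} (hv : IsMPH m k v)
    (S : Finset (Fin m)) :
    ∃ a : Fin m → ℝ, (∀ j, 0 ≤ a j) ∧ ∑ j, a j ≤ k * v S ∧
      ∀ (p : Finset (Fin m) → ℝ) (z : Fin m → ℝ), (∀ R, 0 ≤ p R) → ∑ R, p R = 1 →
        (∀ j, ∑ R, (if j ∈ R then p R else 0) = z j) →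
        v S - ∑ j, a j * z j ≤ ∑ R, v (S \ R) * p R := by
  obtain ⟨a, ha, hak, hav⟩ := hv.exists_prices S
  refine ⟨a, ha, hak, fun p z hp hp1 hpz => ?_⟩
  calc v S - ∑ j, a j * z j = ∑ R, (v S - ∑ j ∈ R, a j) * p R := by
        simp only [sub_mul, sum_sub_distrib, ← mul_sum, hp1, mul_one, ← hpz]
        congr 1
        simp only [mul_sum, sum_mul]
        rw [sum_comm]
        refine sum_congr rfl fun R _ => ?_
        simp [mul_ite, sum_ite_mem]
    _ ≤ _ := sum_le_sum fun R _ => mul_le_mul_of_nonneg_right (hav R) (hp R)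

/-- Removing from every bundle a random set of items with marginals `z` scales the
capacities by `1 - z`. -/
theorem CAFeasible.exists_remove {N : Type*} [Fintype N] {m : ℕ}
    {y : N → Finset (Fin m) → ℝ} (hy : CAFeasible m (fun _ => 1) y)
    {p : Finset (Fin m) → ℝ} {z : Fin m → ℝ} (h1 : ∀ j, z j ≤ 1) (hp : ∀ R, 0 ≤ p R)
    (hp1 : ∑ R, p R = 1) (hpz : ∀ j, ∑ R, (if j ∈ R then p R else 0) = z j) :
    ∃ y' : N → Finset (Fin m) → ℝ, CAFeasible m (fun j => 1 - z j) y' ∧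
      ∀ i (f : Finset (Fin m) → ℝ),
        ∑ S, f S * y' i S = ∑ S, (∑ R, f (S \ R) * p R) * y i S := by
  obtain ⟨hy0, hy1, hyq⟩ := hy
  set y' : N → Finset (Fin m) → ℝ := fun i S' =>
    ∑ S, ∑ R, if S \ R = S' then p R * y i S else 0 with hy'
  have hf : ∀ i (f : Finset (Fin m) → ℝ),
      ∑ S, f S * y' i S = ∑ S, (∑ R, f (S \ R) * p R) * y i S := by
    intro i f
    simp only [hy', mul_sum, sum_mul]
    rw [sum_comm]
    refine sum_congr rfl fun S _ => ?_
    rw [sum_comm]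
    refine sum_congr rfl fun R _ => ?_
    simp [mul_assoc]
  refine ⟨y', ⟨fun i S' => ?_, fun i => ?_, fun j => ?_⟩, hf⟩
  · refine sum_nonneg fun S _ => sum_nonneg fun R _ => ?_
    split_ifs
    exacts [mul_nonneg (hp R) (hy0 i S), le_rfl]
  · have := hf i (fun _ => 1)
    simp only [one_mul, hp1] at this
    exact this.trans_le (hy1 i)
  · have hsum : ∀ i, ∑ S ∈ univ.filter (fun S : Finset (Fin m) => j ∈ S), y' i S
        = (1 - z j) * ∑ S ∈ univ.filter (fun S : Finset (Fin m) => j ∈ S), y i S := by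
      intro i
      have := hf i (fun S => if j ∈ S then 1 else 0)
      simp only [ite_mul, one_mul, zero_mul] at this
      rw [sum_filter, this, sum_filter, mul_sum]
      refine sum_congr rfl fun S _ => ?_
      split_ifs with hj
      · congr 1
        rw [← hp1, ← hpz, ← sum_sub_distrib]
        refine sum_congr rfl fun R _ => ?_
        by_cases hR : j ∈ R <;> simp [hj, hR]
      · simp [hj]
    simp only [hsum, ← mul_sum]
    exact mul_le_of_le_one_right (sub_nonneg.2 (h1 j)) (hyq j)

theorem le_caW {N : Type*} [Fintype N] {m : ℕ} {b : N → Finset (Fin m) → ℝ}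
    (hb : ∀ i S, 0 ≤ b i S) {q : Fin m → ℝ} {x : N → Finset (Fin m) → ℝ}
    (hx : CAFeasible m q x) : ∑ i, ∑ S, b i S * x i S ≤ caW m b q := by
  refine le_csSup ⟨∑ i, ∑ S, b i S, ?_⟩ ⟨x, hx, rfl⟩
  rintro _ ⟨y, ⟨hy0, hy1, -⟩, rfl⟩
  exact sum_le_sum fun i _ => sum_le_sum fun S _ => mul_le_of_le_one_right (hb i S)
    ((single_le_sum (fun T _ => hy0 i T) (mem_univ S)).trans (hy1 i))

theorem caW_set_nonempty {N : Type*} [Fintype N] (m : ℕ) (b : N → Finset (Fin m) → ℝ) :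
    {w : ℝ | ∃ x : N → Finset (Fin m) → ℝ, CAFeasible m (fun _ => 1) x ∧
      w = ∑ i, ∑ S, b i S * x i S}.Nonempty :=
  ⟨_, 0, ⟨by simp, by simp, by simp⟩, rfl⟩

theorem caW_mono {N : Type*} [Fintype N] {m : ℕ} {b c : N → Finset (Fin m) → ℝ}
    (hb : ∀ i S, 0 ≤ b i S) (hcb : ∀ i S, c i S ≤ b i S) :
    caW m c (fun _ => 1) ≤ caW m b (fun _ => 1) := by
  refine csSup_le (caW_set_nonempty m c) ?_
  rintro _ ⟨y, hy, rfl⟩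
  exact (sum_le_sum fun i _ => sum_le_sum fun S _ =>
    mul_le_mul_of_nonneg_right (hcb i S) (hy.1 i S)).trans (le_caW hb hy)

theorem sum_update_zero_mul {N : Type*} [Fintype N] [DecidableEq N] {m : ℕ}
    (b y : N → Finset (Fin m) → ℝ) (i : N) :
    ∑ i', ∑ S, Function.update b i 0 i' S * y i' S
      = ∑ i', ∑ S, b i' S * y i' S - ∑ S, b i S * y i S := by
  rw [eq_sub_iff_add_eq, ← add_sum_erase _ _ (mem_univ i),
    ← add_sum_erase univ (fun i' => ∑ S, b i' S * y i' S) (mem_univ i)]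
  have : ∑ i' ∈ univ.erase i, ∑ S, Function.update b i 0 i' S * y i' S
      = ∑ i' ∈ univ.erase i, ∑ S, b i' S * y i' S :=
    sum_congr rfl fun i' hi' => by rw [Function.update_of_ne (ne_of_mem_erase hi')]
  rw [this]
  simp [add_comm]

/-- **Lemma 7 of the paper.** For MPH-`k` bids `b` and any fractional
allocation `x` feasible for the all-ones capacities,
`∑ i (W^{b₋ᵢ}(1) − W^{b₋ᵢ}(1 − xᵢ)) ≤ (k+1)·W^b(1)`. -/
theorem mph_net_loss_bound
    {N : Type*} [Fintype N] [DecidableEq N] (m k : ℕ) (hk : 1 ≤ k)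
    (b : N → Finset (Fin m) → ℝ) (hb : ∀ i, IsMPH m k (b i))
    (x : N → Finset (Fin m) → ℝ) (hx : CAFeasible m (fun _ => 1) x) :
    ∑ i, (caW m (Function.update b i 0) (fun _ => 1)
          - caW m (Function.update b i 0)
              (fun j => 1 - ∑ S ∈ univ.filter (fun S : Finset (Fin m) => j ∈ S), x i S))
      ≤ ((k : ℝ) + 1) * caW m b (fun _ => 1) := by
  have hbn : ∀ i S, 0 ≤ b i S := fun i => (hb i).nonneg
  have hun : ∀ i i' S, 0 ≤ Function.update b i 0 i' S := fun i i' S => by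
    rcases eq_or_ne i' i with rfl | h
    · simp
    · simpa [h] using hbn i' S
  have hub : ∀ i i' S, Function.update b i 0 i' S ≤ b i' S := fun i i' S => by
    rcases eq_or_ne i' i with rfl | h
    · simpa using hbn i' S
    · simp [h]
  choose a ha hak hav using fun i S => (hb i).exists_prices_average S
  set z : N → Fin m → ℝ :=
    fun i j => ∑ S ∈ univ.filter (fun S : Finset (Fin m) => j ∈ S), x i S with hz
  have hz0 : ∀ i j, 0 ≤ z i j := fun i j => sum_nonneg fun S _ => hx.1 i S
  have hzs : ∀ j, ∑ i, z i j ≤ 1 := hx.2.2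
  have hz1 : ∀ i j, z i j ≤ 1 := fun i j =>
    (single_le_sum (fun i' _ => hz0 i' j) (mem_univ i)).trans (hzs j)
  set W := caW m b (fun _ => 1) with hW
  -- The loss caused by one bidder, relative to any reference allocation `y`.
  have hloss : ∀ y, CAFeasible m (fun _ => 1) y → ∀ i,
      caW m (Function.update b i 0) (fun _ => 1)
          - caW m (Function.update b i 0) (fun j => 1 - z i j)
        ≤ (W - ∑ i', ∑ S, b i' S * y i' S) + ∑ S, b i S * y i S
          + ∑ i', ∑ S, (∑ j, a i' S j * z i j) * y i' S := by
    intro y hy i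
    obtain ⟨p, hp, hp1, hpz⟩ := exists_weight_with_marginals (z i) (hz0 i) (hz1 i)
    obtain ⟨y', hy', hf⟩ := hy.exists_remove (hz1 i) hp hp1 hpz
    have hmono : caW m (Function.update b i 0) (fun _ => 1) ≤ W := caW_mono hbn (hub i)
    have hlow := le_caW (hun i) hy'
    have hterm : ∑ i', ∑ S, (Function.update b i 0 i' S - ∑ j, a i' S j * z i j) * y i' S
        ≤ ∑ i', ∑ S, Function.update b i 0 i' S * y' i' S := by
      refine sum_le_sum fun i' _ => ?_
      rw [hf]
      refine sum_le_sum fun S _ => mul_le_mul_of_nonneg_right ?_ (hy.1 i' S)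
      rcases eq_or_ne i' i with rfl | h
      · simpa using sum_nonneg fun j _ => mul_nonneg (ha i' S j) (hz0 i' j)
      · simpa [h] using hav i' S p (z i) hp hp1 hpz
    simp only [sub_mul, sum_sub_distrib, sum_update_zero_mul] at hterm hlow
    linarith
  have hprice : ∀ y, CAFeasible m (fun _ => 1) y →
      ∑ i, ∑ i', ∑ S, (∑ j, a i' S j * z i j) * y i' S
        ≤ k * ∑ i', ∑ S, b i' S * y i' S := by
    intro y hy
    rw [sum_comm, mul_sum]
    refine sum_le_sum fun i' _ => ?_
    rw [sum_comm, mul_sum]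
    refine sum_le_sum fun S _ => ?_
    rw [← sum_mul, ← mul_assoc]
    refine mul_le_mul_of_nonneg_right (le_trans ?_ (hak i' S)) (hy.1 i' S)
    rw [sum_comm]
    refine sum_le_sum fun j _ => ?_
    rw [← mul_sum]
    exact mul_le_of_le_one_right (ha i' S j) (hzs j)
  refine le_of_forall_pos_le_add fun ε hε => ?_
  have hcard : (0 : ℝ) < Fintype.card N + 1 := by positivity
  obtain ⟨_, ⟨y, hy, rfl⟩, hyW⟩ := exists_lt_of_lt_csSup (caW_set_nonempty m b)
    (show W - ε / (Fintype.card N + 1) < _ from sub_lt_self W (div_pos hε hcard))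
  have hsum := sum_le_sum fun i (_ : i ∈ univ) => hloss y hy i
  rw [sum_add_distrib, sum_add_distrib, sum_const, card_univ, nsmul_eq_mul] at hsum
  have hgap : (Fintype.card N : ℝ) * (W - ∑ i', ∑ S, b i' S * y i' S) ≤ ε := by
    have hle : (Fintype.card N : ℝ) * (W - ∑ i', ∑ S, b i' S * y i' S)
        ≤ (Fintype.card N + 1) * (ε / (Fintype.card N + 1)) :=
      mul_le_mul (by linarith) (by linarith) (sub_nonneg.2 (le_caW hbn hy)) hcard.le
    rwa [mul_div_cancel₀ _ hcard.ne'] at hle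
  have hV : ((k : ℝ) + 1) * ∑ i', ∑ S, b i' S * y i' S ≤ (k + 1) * W :=
    mul_le_mul_of_nonneg_left (le_caW hbn hy) (by positivity)
  linarith [hprice y hy]
end

section
/- Suppose r is an α-approximate oblivious rounding scheme for the configuration LP with respect to MPH-k valuations (α ≥ 1). Consider the randomized pay-your-bid mechanism that, on a profile b of MPH-k bids, computes a feasible fractional allocation x̂(b) maximizing declared welfare and outputs an integral allocation S ∼ r(x̂(b)). Let v be a profile of MPH-k valuations and let b be a profile of MPH-k bids that is a pure Nash equilibrium of the expected-utility game under v (no bidder i can increase U_i by unilaterally deviating to any MPH-k bid b'_i) at which U_i(b,v) ≥ 0 for all i. Then the expected welfare satisfies E_{S∼r(x̂(b))}[∑_{i∈N} v_i(S_i)] ≥ (1/(2α(k+1)))·max over integral allocations S' of ∑_{i∈N} v_i(S'_i). -/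
open Finset

namespace IsMPH

variable {m k : ℕ} {f : Finset (Fin m) → ℝ}

/-- An MPH function is supported at each bundle by one of its hypergraphs, which bounds it from
below everywhere. -/
theorem exists_supporting (hf : IsMPH m k f) (S : Finset (Fin m)) :
    ∃ w : Finset (Fin m) → ℝ, (∀ T, 0 ≤ w T) ∧
      f S = ∑ T ∈ S.powerset.filter (fun T => 1 ≤ T.card ∧ T.card ≤ k), w T ∧
      ∀ R, ∑ T ∈ R.powerset.filter (fun T => 1 ≤ T.card ∧ T.card ≤ k), w T ≤ f R := by
  obtain ⟨n, w, hw, hfw⟩ := hf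
  obtain ⟨l, -, hl⟩ := exists_mem_eq_sup' (univ_nonempty (α := Fin (n + 1)))
    (fun l => ∑ T ∈ S.powerset.filter (fun T : Finset (Fin m) => 1 ≤ T.card ∧ T.card ≤ k), w l T)
  refine ⟨w l, hw l, (hfw S).trans hl, fun R => ?_⟩
  rw [hfw R]
  exact le_sup' (fun l => ∑ T ∈ R.powerset.filter (fun T => 1 ≤ T.card ∧ T.card ≤ k), w l T)
    (mem_univ l)

theorem nonneg_s18 (hf : IsMPH m k f) (S : Finset (Fin m)) : 0 ≤ f S := by
  obtain ⟨w, hw, h, -⟩ := hf.exists_supporting S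
  rw [h]
  exact sum_nonneg fun T _ => hw T

theorem mono (hf : IsMPH m k f) {R S : Finset (Fin m)} (hRS : R ⊆ S) : f R ≤ f S := by
  obtain ⟨w, hw, h, hle⟩ := hf.exists_supporting R
  rw [h]
  exact (sum_le_sum_of_subset_of_nonneg
    (filter_subset_filter _ (powerset_mono.2 hRS)) fun T _ _ => hw T).trans (hle S)

theorem const_mul (hf : IsMPH m k f) {c : ℝ} (hc : 0 ≤ c) : IsMPH m k (fun S => c * f S) := by
  obtain ⟨n, w, hw, hfw⟩ := hf
  refine ⟨n, fun l T => c * w l T, fun l T => mul_nonneg hc (hw l T), fun S => ?_⟩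
  simp only [hfw S, ← mul_sum, mul₀_sup' hc]

/-- The total marginal value of the members of a disjoint family of bundles within `S` is at most
`k` times the value of `S`. -/
theorem sum_sub_sdiff_le {N : Type*} [Fintype N] (hf : IsMPH m k f) (S : Finset (Fin m))
    (A : N → Finset (Fin m)) (hA : ∀ i j, i ≠ j → Disjoint (A i) (A j)) :
    ∑ i, (f S - f (S \ A i)) ≤ k * f S := by
  obtain ⟨w, hw, h, hle⟩ := hf.exists_supporting S
  have hloss (i : N) : f S - f (S \ A i) ≤
      ∑ T ∈ S.powerset.filter (fun T => 1 ≤ T.card ∧ T.card ≤ k),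
        if Disjoint T (A i) then 0 else w T := by
    have hkeep : ∑ T ∈ S.powerset.filter (fun T => 1 ≤ T.card ∧ T.card ≤ k),
        (if Disjoint T (A i) then w T else 0) ≤ f (S \ A i) := by
      rw [← sum_filter]
      refine le_trans (le_of_eq (sum_congr ?_ fun _ _ => rfl)) (hle (S \ A i))
      ext T
      simp only [mem_filter, mem_powerset, subset_sdiff]
      tauto
    have hsplit : f S = ∑ T ∈ S.powerset.filter (fun T => 1 ≤ T.card ∧ T.card ≤ k),
        (if Disjoint T (A i) then w T else 0) +
        ∑ T ∈ S.powerset.filter (fun T => 1 ≤ T.card ∧ T.card ≤ k),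
          if Disjoint T (A i) then 0 else w T := by
      rw [h, ← sum_add_distrib]
      refine sum_congr rfl fun T _ => ?_
      split_ifs <;> simp
    linarith
  refine (sum_le_sum fun i _ => hloss i).trans ?_
  rw [sum_comm, h, mul_sum]
  refine sum_le_sum fun T hT => ?_
  have hTk : T.card ≤ k := (mem_filter.1 hT).2.2
  have hcard : (univ.filter fun i => ¬ Disjoint T (A i)).card ≤ T.card := by
    have hmeet : ∀ i ∈ univ.filter fun i => ¬ Disjoint T (A i), ∃ t ∈ T, t ∈ A i :=
      fun i hi => not_disjoint_iff.1 (mem_filter.1 hi).2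
    refine card_le_card_of_forall_subsingleton (fun i t => t ∈ A i) hmeet fun t _ i hi j hj => ?_
    by_contra hij
    exact disjoint_left.1 (hA i j hij) hi.2 hj.2
  have hcount : ∑ i, (if Disjoint T (A i) then 0 else w T) =
      ((univ.filter fun i => ¬ Disjoint T (A i)).card : ℝ) * w T := by
    rw [← nsmul_eq_mul, ← sum_const, sum_filter]
    simp only [ite_not]
  rw [hcount]
  exact mul_le_mul_of_nonneg_right (by exact_mod_cast hcard.trans hTk) (hw T)

end IsMPH

/-- The fractional allocation in which bidder `i` gets the bundle `A` and every other bidder keeps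
the part of its share in `x` outside `A`. -/
def reassign {N : Type*} [DecidableEq N] {m : ℕ} (x : N → Finset (Fin m) → ℝ) (i : N)
    (A : Finset (Fin m)) : N → Finset (Fin m) → ℝ :=
  fun j T => if j = i then (if T = A then 1 else 0) else ∑ S, if S \ A = T then x j S else 0

section Reassign

variable {N : Type*} [DecidableEq N] {m : ℕ} (x : N → Finset (Fin m) → ℝ) (A : Finset (Fin m))

theorem sum_mul_reassign_self (i : N) (f : Finset (Fin m) → ℝ) :
    ∑ T, f T * reassign x i A i T = f A := by
  simp [reassign]

theorem sum_mul_reassign_of_ne {i j : N} (hji : j ≠ i) (f : Finset (Fin m) → ℝ) :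
    ∑ T, f T * reassign x i A j T = ∑ S, f (S \ A) * x j S := by
  simp only [reassign, if_neg hji, mul_sum]
  rw [sum_comm]
  simp

variable {x}

theorem CAFeasible.reassign [Fintype N] (hx : CAFeasible m (fun _ => 1) x) (i : N) :
    CAFeasible m (fun _ => 1) (reassign x i A) := by
  obtain ⟨h0, h1, h2⟩ := hx
  refine ⟨fun j T => ?_, fun j => ?_, fun t => ?_⟩
  · unfold _root_.reassign
    split_ifs
    · exact zero_le_one
    · exact le_rfl
    · exact sum_nonneg fun S _ => by split_ifs <;> simp [h0]
  · by_cases hji : j = i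
    · subst hji
      simpa using (sum_mul_reassign_self x A j fun _ => 1).le
    · have := sum_mul_reassign_of_ne x A hji fun _ => 1
      simp only [one_mul] at this
      exact this.trans_le (h1 j)
  · have hind (z : Finset (Fin m) → ℝ) :
        ∑ S ∈ univ.filter (fun S : Finset (Fin m) => t ∈ S), z S =
          ∑ S, (if t ∈ S then 1 else 0) * z S := by
      rw [sum_filter]
      simp
    have h2t := h2 t
    simp only [hind] at h2t ⊢
    by_cases ht : t ∈ A
    · rw [sum_eq_single i]
      · rw [sum_mul_reassign_self]
        simp [ht]
      · intro j _ hji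
        rw [sum_mul_reassign_of_ne x A hji]
        simp [ht]
      · simp
    · refine le_trans (sum_le_sum fun j _ => ?_) h2t
      by_cases hji : j = i
      · subst hji
        rw [sum_mul_reassign_self, if_neg ht]
        exact sum_nonneg fun S _ => mul_nonneg (by split_ifs <;> simp) (h0 _ S)
      · rw [sum_mul_reassign_of_ne x A hji]
        simp [ht]

end Reassign

/-- If `x` and `x'` are optimal for the bids `b` and for the bids in which bidder `i` deviates to
`b'`, then the declared value that `i` obtains from `x'` is at least `b' A` minus the loss that
handing the bundle `A` to bidder `i` causes in `x`. -/
theorem le_deviation_value_add_loss {N : Type*} [Fintype N] [DecidableEq N] {m k : ℕ}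
    {b x x' : N → Finset (Fin m) → ℝ} {b' : Finset (Fin m) → ℝ} {i : N}
    (hb : ∀ j, IsMPH m k (b j))
    (hx : CAFeasible m (fun _ => 1) x) (hx' : CAFeasible m (fun _ => 1) x')
    (hopt : ∀ y, CAFeasible m (fun _ => 1) y → ∑ j, ∑ S, b j S * y j S ≤ ∑ j, ∑ S, b j S * x j S)
    (hopt' : ∀ y, CAFeasible m (fun _ => 1) y →
      ∑ j, ∑ S, Function.update b i b' j S * y j S ≤
        ∑ j, ∑ S, Function.update b i b' j S * x' j S)
    (A : Finset (Fin m)) :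
    b' A ≤ ∑ S, b' S * x' i S + ∑ j, ∑ S, (b j S - b j (S \ A)) * x j S +
      ∑ S, b i S * x i S := by
  have hdev := hopt' _ (hx.reassign A i)
  have hother (z : N → Finset (Fin m) → ℝ) :
      ∑ j ∈ univ.erase i, ∑ S, Function.update b i b' j S * z j S =
        ∑ j ∈ univ.erase i, ∑ S, b j S * z j S :=
    sum_congr rfl fun j hj => by rw [Function.update_of_ne (ne_of_mem_erase hj)]
  rw [← add_sum_erase _ _ (mem_univ i), ← add_sum_erase _ _ (mem_univ i), Function.update_self,
    sum_mul_reassign_self, hother, hother,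
    sum_congr rfl fun j hj => sum_mul_reassign_of_ne x A (ne_of_mem_erase hj) (b j)] at hdev
  have hcur := hopt _ hx'
  rw [← add_sum_erase _ _ (mem_univ i)] at hcur
  have hpos : 0 ≤ ∑ S, b i S * x' i S :=
    sum_nonneg fun S _ => mul_nonneg ((hb i).nonneg_s18 S) (hx'.1 i S)
  have hmono : ∑ S, b i (S \ A) * x i S ≤ ∑ S, b i S * x i S :=
    sum_le_sum fun S _ => mul_le_mul_of_nonneg_right ((hb i).mono sdiff_subset) (hx.1 i S)
  have hkept := add_sum_erase univ (fun j => ∑ S, b j (S \ A) * x j S) (mem_univ i)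
  simp only [sub_mul, sum_sub_distrib] at hkept ⊢
  linarith

/-- The losses caused in `x` by handing each bidder its bundle in an integral allocation add up
to at most `k` times the declared welfare of `x`. -/
theorem sum_loss_le {N : Type*} [Fintype N] {m k : ℕ} {b x : N → Finset (Fin m) → ℝ}
    (hb : ∀ j, IsMPH m k (b j)) (hx : ∀ j S, 0 ≤ x j S)
    (A : N → Finset (Fin m)) (hA : ∀ i j, i ≠ j → Disjoint (A i) (A j)) :
    ∑ i, ∑ j, ∑ S, (b j S - b j (S \ A i)) * x j S ≤ k * ∑ j, ∑ S, b j S * x j S := by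
  rw [sum_comm, mul_sum]
  refine sum_le_sum fun j _ => ?_
  rw [sum_comm, mul_sum]
  refine sum_le_sum fun S _ => ?_
  rw [← sum_mul, ← mul_assoc]
  exact mul_le_mul_of_nonneg_right ((hb j).sum_sub_sdiff_le S A hA) (hx j S)

/-- **Theorem 6 of the paper, pure Nash version.** The relax-and-round
pay-your-bid mechanism for combinatorial auctions with MPH-`k` valuations, built from an
exact solver of the configuration LP and an `α`-approximate oblivious rounding scheme,
guarantees at every pure Nash equilibrium (of the expected-utility game) with
nonnegative utilities an expected welfare of at least a `1/(2α(k+1))`-fraction of the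
optimal integral welfare. -/
theorem ca_relax_and_round_poa
    {N : Type*} [Fintype N] [DecidableEq N] (m k : ℕ) (hk : 1 ≤ k)
    (xhat : (N → Finset (Fin m) → ℝ) → (N → Finset (Fin m) → ℝ))
    (hfeas : ∀ b : N → Finset (Fin m) → ℝ, (∀ i, IsMPH m k (b i)) →
      CAFeasible m (fun _ => 1) (xhat b))
    (hopt : ∀ b : N → Finset (Fin m) → ℝ, (∀ i, IsMPH m k (b i)) →
      ∀ y : N → Finset (Fin m) → ℝ, CAFeasible m (fun _ => 1) y →
        ∑ i, ∑ S, b i S * xhat b i S ≥ ∑ i, ∑ S, b i S * y i S)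
    (α : ℝ) (hα : 1 ≤ α)
    (r : (N → Finset (Fin m) → ℝ) → (N → Finset (Fin m)) → ℝ)
    (hr0 : ∀ x' : N → Finset (Fin m) → ℝ, CAFeasible m (fun _ => 1) x' →
      ∀ S : N → Finset (Fin m), 0 ≤ r x' S)
    (hr1 : ∀ x' : N → Finset (Fin m) → ℝ, CAFeasible m (fun _ => 1) x' →
      ∑ S : N → Finset (Fin m), r x' S = 1)
    (hrsupp : ∀ x' : N → Finset (Fin m) → ℝ, CAFeasible m (fun _ => 1) x' →
      ∀ S : N → Finset (Fin m), r x' S ≠ 0 → ∀ i j : N, i ≠ j → Disjoint (S i) (S j))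
    (hobl : ∀ x' : N → Finset (Fin m) → ℝ, CAFeasible m (fun _ => 1) x' →
      ∀ (i : N) (w : Finset (Fin m) → ℝ), IsMPH m k w →
        ∑ S : N → Finset (Fin m), r x' S * w (S i) ≥ 1 / α * ∑ T, w T * x' i T)
    (v b : N → Finset (Fin m) → ℝ)
    (hv : ∀ i, IsMPH m k (v i)) (hb : ∀ i, IsMPH m k (b i))
    (hNash : ∀ (i : N) (b' : Finset (Fin m) → ℝ), IsMPH m k b' →
      ∑ S : N → Finset (Fin m), r (xhat b) S * (v i (S i) - b i (S i))
        ≥ ∑ S : N → Finset (Fin m), r (xhat (Function.update b i b')) S *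
            (v i (S i) - b' (S i)))
    (hIR : ∀ i : N,
      0 ≤ ∑ S : N → Finset (Fin m), r (xhat b) S * (v i (S i) - b i (S i))) :
    ∑ S : N → Finset (Fin m), r (xhat b) S * ∑ i, v i (S i)
      ≥ 1 / (2 * α * ((k : ℝ) + 1)) *
        sSup {w : ℝ | ∃ S' : N → Finset (Fin m),
          (∀ i j : N, i ≠ j → Disjoint (S' i) (S' j)) ∧ w = ∑ i, v i (S' i)} := by
  have hα0 : 0 < α := by linarith
  have hk0 : (0 : ℝ) < (k : ℝ) + 1 := by positivity
  have hxb := hfeas b hb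
  have hpay (i : N) := hobl _ hxb i (b i) (hb i)
  have hwelfare : ∑ S : N → Finset (Fin m), r (xhat b) S * ∑ i, v i (S i) =
      ∑ i, ∑ S : N → Finset (Fin m), r (xhat b) S * (v i (S i) - b i (S i)) +
        ∑ i, ∑ S : N → Finset (Fin m), r (xhat b) S * b i (S i) := by
    simp only [← sum_add_distrib, mul_sum, ← mul_add, sub_add_cancel]
    exact sum_comm
  rw [ge_iff_le, one_div_mul_eq_div, div_le_iff₀ (by positivity)]
  refine csSup_le ⟨_, fun _ => ∅, fun i j _ => disjoint_empty_left _, rfl⟩ ?_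
  rintro _ ⟨A, hA, rfl⟩
  have hdev (i : N) : 1 / 2 * v i (A i) ≤
      α * ∑ S : N → Finset (Fin m), r (xhat b) S * (v i (S i) - b i (S i)) +
      ∑ j, ∑ S, (b j S - b j (S \ A i)) * xhat b j S + ∑ S, b i S * xhat b i S := by
    have hhalf : IsMPH m k (fun S => 1 / 2 * v i S) := (hv i).const_mul (by norm_num)
    have hbi : ∀ j, IsMPH m k (Function.update b i (fun S => 1 / 2 * v i S) j) := by
      intro j
      rcases eq_or_ne j i with rfl | hji
      · rwa [Function.update_self]
      · rw [Function.update_of_ne hji]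
        exact hb j
    have hround := hobl _ (hfeas _ hbi) i _ hhalf
    have hnash := hNash i _ hhalf
    have hutil (a : ℝ) : a - 1 / 2 * a = 1 / 2 * a := by ring
    simp only [hutil] at hnash
    have hgain := hround.le.trans hnash.le
    rw [one_div_mul_eq_div, div_le_iff₀' hα0] at hgain
    have hloss := le_deviation_value_add_loss hb hxb (hfeas _ hbi) (hopt b hb) (hopt _ hbi) (A i)
    linarith
  have hsum := sum_le_sum fun i (_ : i ∈ univ) => hdev i
  rw [sum_add_distrib, sum_add_distrib, ← mul_sum, ← mul_sum] at hsum
  have hloss := sum_loss_le hb hxb.1 A hA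
  have hpaid := sum_le_sum fun i (_ : i ∈ univ) => (hpay i).le
  rw [← mul_sum, one_div_mul_eq_div, div_le_iff₀' hα0] at hpaid
  have hutil := sum_nonneg fun i (_ : i ∈ univ) => hIR i
  rw [hwelfare]
  set U := ∑ i, ∑ S : N → Finset (Fin m), r (xhat b) S * (v i (S i) - b i (S i))
  set P := ∑ i, ∑ S : N → Finset (Fin m), r (xhat b) S * b i (S i)
  have hscaled := mul_le_mul_of_nonneg_left hpaid hk0.le
  have hslack : 0 ≤ (k : ℝ) * (α * U) := by positivity
  linarith
end
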